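/- The only rational point on the genus 2 curve y² = (2−x)(7x⁵ − 10x⁴ − 20x³ − 4) is (2, 0); that is, for all rational numbers x and y, if y² = (2−x)(7x⁵ − 10x⁴ − 20x³ − 4), then x = 2 and y = 0. -/

import Mathlib

set_option linter.unusedSimpArgs false
namespace G2
open Polynomial NumberField

/-- The defining polynomial of the quintic field. -/
noncomputable abbrev qpol : ℚ[X] := X ^ 5 - C 2

theorem zpol_irr : Irreducible (X ^ 5 - C 2 : ℤ[X]) := by
  have hm : (X ^ 5 - C 2 : ℤ[X]).Monic := monic_X_pow_sub_C 2 (by norm_num)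
  have hd : (X ^ 5 - C 2 : ℤ[X]).natDegree = 5 := natDegree_X_pow_sub_C
  have he : (X ^ 5 - C 2 : ℤ[X]).IsEisensteinAt (Ideal.span {(2 : ℤ)}) := by
    refine ⟨?_, ?_, ?_⟩
    · rw [hm.leadingCoeff, Ideal.mem_span_singleton]; norm_num
    · intro n hn
      rw [hd] at hn
      rw [Ideal.mem_span_singleton]
      interval_cases n <;> simp [coeff_X_pow, coeff_C]
    · rw [Ideal.span_singleton_pow, Ideal.mem_span_singleton]
      simp [coeff_X_pow, coeff_C]
  refine he.irreducible ?_ hm.isPrimitive (by rw [hd]; norm_num)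
  exact (Ideal.span_singleton_prime (by norm_num)).2 Int.prime_two

theorem qpol_irr : Irreducible qpol := by
  have hm : (X ^ 5 - C 2 : ℤ[X]).Monic := monic_X_pow_sub_C 2 (by norm_num)
  have := (hm.irreducible_iff_irreducible_map_fraction_map (K := ℚ)).1 zpol_irr
  rw [Polynomial.map_sub, Polynomial.map_pow, map_X, map_C] at this
  exact this

instance : Fact (Irreducible qpol) := ⟨qpol_irr⟩

/-- The quintic field. -/
noncomputable abbrev L := AdjoinRoot qpol

theorem qpol_ne : qpol ≠ 0 := qpol_irr.ne_zero

noncomputable def pb : PowerBasis ℚ L := AdjoinRoot.powerBasis qpol_ne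

instance : FiniteDimensional ℚ L := pb.finite
instance : NumberField L := { to_charZero := inferInstance, to_finiteDimensional := inferInstance }

/-- The fifth root of two. -/
noncomputable def al : L := AdjoinRoot.root qpol

theorem al5 : al ^ 5 = 2 := by
  have := AdjoinRoot.eval₂_root qpol
  simp [eval₂_sub] at this
  exact sub_eq_zero.1 this

theorem qdeg : qpol.natDegree = 5 := natDegree_X_pow_sub_C
theorem pb_dim : pb.dim = 5 := by simp [pb, qdeg]
theorem pb_gen : pb.gen = al := by simp [pb, al]
theorem finrank_L : Module.finrank ℚ L = 5 := by rw [pb.finrank, pb_dim]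

theorem minpoly_al_Q : minpoly ℚ al = qpol := by
  symm
  apply minpoly.eq_of_irreducible_of_monic qpol_irr
  · simp [al5]
  · exact monic_X_pow_sub_C 2 (by norm_num)

theorem al_int : IsIntegral ℤ al := ⟨X ^ 5 - C 2, monic_X_pow_sub_C 2 (by norm_num), by simp [al5]⟩

theorem minpoly_al_Z : minpoly ℤ al = X ^ 5 - C 2 := by
  have h := minpoly.isIntegrallyClosed_eq_field_fractions' ℚ al_int
  rw [minpoly_al_Q] at h
  apply map_injective (algebraMap ℤ ℚ) (algebraMap ℤ ℚ).injective_int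
  rw [← h]; rw [Polynomial.map_sub, Polynomial.map_pow, map_X, map_C]; rfl

theorem norm_al : Algebra.norm ℚ al = 2 := by
  have := Algebra.PowerBasis.norm_gen_eq_coeff_zero_minpoly pb
  rw [pb_gen, minpoly_al_Q, pb_dim] at this
  simp [coeff_X_pow] at this
  rw [this]; norm_num

theorem discr_pb : Algebra.discr ℚ pb.basis = 50000 := by
  rw [Algebra.discr_powerBasis_eq_norm, pb_gen, minpoly_al_Q, finrank_L]
  have : aeval al (derivative qpol) = algebraMap ℚ L 5 * al ^ 4 := by
    simp only [derivative_sub, derivative_X_pow, derivative_C, sub_zero, map_mul, map_pow, aeval_X, aeval_C]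
    norm_num
  rw [this, map_mul, map_pow, norm_al, Algebra.norm_algebraMap, finrank_L]
  norm_num

theorem mem_adj (z : L) (hz : IsIntegral ℤ z) : z ∈ Algebra.adjoin ℤ ({al} : Set L) := by
  have hgenint : IsIntegral ℤ pb.gen := by rw [pb_gen]; exact al_int
  have H := Algebra.discr_mul_isIntegral_mem_adjoin ℚ hgenint hz
  rw [discr_pb, pb_gen] at H
  have hadj : Algebra.adjoin ℤ ({al - 2} : Set L) = Algebra.adjoin ℤ ({al} : Set L) := by
    apply le_antisymm
    · apply Algebra.adjoin_le
      simp only [Set.singleton_subset_iff, SetLike.mem_coe]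
      exact sub_mem (Algebra.self_mem_adjoin_singleton ℤ al) (by exact_mod_cast Subalgebra.intCast_mem _ 2)
    · apply Algebra.adjoin_le
      simp only [Set.singleton_subset_iff, SetLike.mem_coe]
      have := add_mem (Algebra.self_mem_adjoin_singleton ℤ (al - 2)) 
        (show (2:L) ∈ Algebra.adjoin ℤ ({al - 2} : Set L) by exact_mod_cast Subalgebra.intCast_mem _ 2)
      simpa using this
  -- the prime 2
  have h2 : (5 ^ 5 : ℤ) • z ∈ Algebra.adjoin ℤ ({pb.gen} : Set L) := by
    refine mem_adjoin_of_smul_prime_pow_smul_of_minpoly_isEisensteinAt (K := ℚ) (p := (2:ℤ)) (n := 4)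
      Int.prime_two hgenint (hz.smul _) ?_ ?_
    · rw [pb_gen]
      convert H using 1
      rw [smul_smul, Algebra.smul_def, Algebra.smul_def]; norm_num
    · rw [pb_gen, minpoly_al_Z]
      have hm : (X ^ 5 - C 2 : ℤ[X]).Monic := monic_X_pow_sub_C 2 (by norm_num)
      have hd : (X ^ 5 - C 2 : ℤ[X]).natDegree = 5 := natDegree_X_pow_sub_C
      refine ⟨?_, ?_, ?_⟩
      · rw [hm.leadingCoeff, Submodule.mem_span_singleton]; rintro ⟨a, ha⟩; simp at ha; omega
      · intro n hn
        rw [hd] at hn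
        change _ ∈ Ideal.span _
        rw [Ideal.mem_span_singleton]
        interval_cases n <;> simp [coeff_X_pow, coeff_C]
      · change _ ∉ (Ideal.span _) ^ 2
        rw [Ideal.span_singleton_pow, Ideal.mem_span_singleton]
        simp [coeff_X_pow, coeff_C]
  -- the prime 5
  have hgenint : IsIntegral ℤ (al - 2) := al_int.sub (by exact_mod_cast isIntegral_algebraMap (x := (2:ℤ)))
  have htop : Algebra.adjoin ℚ ({al - 2} : Set L) = ⊤ := by
    rw [eq_top_iff, ← pb.adjoin_gen_eq_top, pb_gen]
    apply Algebra.adjoin_le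
    simp only [Set.singleton_subset_iff, SetLike.mem_coe]
    have := add_mem (Algebra.self_mem_adjoin_singleton ℚ (al - 2)) 
        (show (2:L) ∈ Algebra.adjoin ℚ ({al - 2} : Set L) by exact_mod_cast Subalgebra.intCast_mem _ 2)
    simpa using this
  let B : PowerBasis ℚ L := PowerBasis.ofAdjoinEqTop (x := al - 2) (hgenint.tower_top) htop
  have hB : B.gen = al - 2 := PowerBasis.ofAdjoinEqTop_gen _ _
  rw [← hadj, ← hB]
  have hmon : ((X + C 2) ^ 5 - C 2 : ℤ[X]).Monic := by
    have := (monic_X_pow_sub_C (2:ℤ) (show 5 ≠ 0 by norm_num)).comp_X_add_C 2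
    simpa using this
  have hmin : minpoly ℤ (al - 2) = (X + C 2) ^ 5 - C 2 := by
    have h1 : minpoly ℚ (al - algebraMap ℚ L 2) = qpol.comp (X + C 2) := by
      rw [minpoly.sub_algebraMap, minpoly_al_Q]
    have h := minpoly.isIntegrallyClosed_eq_field_fractions' ℚ hgenint
    apply map_injective (algebraMap ℤ ℚ) (algebraMap ℤ ℚ).injective_int
    rw [← h]
    rw [show algebraMap ℚ L 2 = 2 from map_ofNat _ 2] at h1
    rw [h1]; simp only [Polynomial.map_sub, Polynomial.map_pow, Polynomial.map_add, map_X, map_C, sub_comp, pow_comp, X_comp, C_comp]; rfl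
  refine mem_adjoin_of_smul_prime_pow_smul_of_minpoly_isEisensteinAt (K := ℚ) (p := (5:ℤ)) (n := 5)
      (by norm_num) (by rw [hB]; exact hgenint) hz ?_ ?_
  · rw [hB, hadj, ← pb_gen]; exact h2
  · rw [hB, hmin]
    have hexp : ((X + C 2) ^ 5 - C 2 : ℤ[X]) = X ^ 5 + C 10 * X ^ 4 + C 40 * X ^ 3 + C 80 * X ^ 2 + C 80 * X + C 30 := by
      have h10 : (C 10 : ℤ[X]) = 5 * C 2 := by rw [← C_ofNat, ← C_mul]; norm_num
      have h40 : (C 40 : ℤ[X]) = 10 * C 2 ^ 2 := by rw [← C_ofNat, ← C_pow, ← C_mul]; norm_num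
      have h80 : (C 80 : ℤ[X]) = 10 * C 2 ^ 3 := by rw [← C_ofNat, ← C_pow, ← C_mul]; norm_num
      have h80' : (C 80 : ℤ[X]) = 5 * C 2 ^ 4 := by rw [← C_ofNat, ← C_pow, ← C_mul]; norm_num
      have h30 : (C 30 : ℤ[X]) = C 2 ^ 5 - C 2 := by rw [← C_pow, ← C_sub]; norm_num
      linear_combination -X ^ 4 * h10 - X ^ 3 * h40 - X ^ 2 * h80 - X * h80' - h30
    have hd : ((X + C 2) ^ 5 - C 2 : ℤ[X]).natDegree = 5 := by
      rw [hexp]; compute_degree!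
    refine ⟨?_, ?_, ?_⟩
    · rw [hmon.leadingCoeff, Submodule.mem_span_singleton]; rintro ⟨a, ha⟩; simp at ha; omega
    · intro n hn
      rw [hd] at hn
      change _ ∈ Ideal.span _
      rw [Ideal.mem_span_singleton, hexp]
      interval_cases n <;> simp [coeff_X_pow, coeff_C, coeff_X] <;> norm_num
    · change _ ∉ (Ideal.span _) ^ 2
      rw [Ideal.span_singleton_pow, Ideal.mem_span_singleton, hexp]
      simp [coeff_X_pow, coeff_C]
end G2

set_option linter.unusedSimpArgs false
namespace G2
open Polynomial NumberField

/-- Fifth root of two as an algebraic integer. -/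
noncomputable def a : 𝓞 L := ⟨al, al_int⟩

theorem a_coe : ((a : 𝓞 L) : L) = al := rfl

theorem a5 : a ^ 5 = 2 := by
  apply RingOfIntegers.ext
  change al ^ 5 = 2
  exact al5

theorem lin_Q (q0 q1 q2 q3 q4 : ℚ) (h : (q0 : L) + q1 * al + q2 * al ^ 2 + q3 * al ^ 3 + q4 * al ^ 4 = 0) :
    q0 = 0 ∧ q1 = 0 ∧ q2 = 0 ∧ q3 = 0 ∧ q4 = 0 := by
  set p : ℚ[X] := C q0 + C q1 * X + C q2 * X ^ 2 + C q3 * X ^ 3 + C q4 * X ^ 4 with hp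
  have hd : p.natDegree ≤ 4 := by rw [hp]; compute_degree
  have h0 : aeval al p = 0 := by
    simp [hp]; exact h
  have hp0 : p = 0 := by
    by_contra hne
    have h1 := natDegree_le_of_dvd (minpoly.dvd ℚ al h0) hne
    rw [minpoly_al_Q, qdeg] at h1
    omega
  have hc : ∀ n, p.coeff n = 0 := by simp [hp0]
  refine ⟨?_, ?_, ?_, ?_, ?_⟩
  · simpa [hp, coeff_X_pow, coeff_X, coeff_C] using hc 0
  · simpa [hp, coeff_X_pow, coeff_X, coeff_C] using hc 1
  · simpa [hp, coeff_X_pow, coeff_X, coeff_C] using hc 2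
  · simpa [hp, coeff_X_pow, coeff_X, coeff_C] using hc 3
  · simpa [hp, coeff_X_pow, coeff_X, coeff_C] using hc 4

theorem lin_Z (q0 q1 q2 q3 q4 : ℤ) (h : (q0 : 𝓞 L) + q1 * a + q2 * a ^ 2 + q3 * a ^ 3 + q4 * a ^ 4 = 0) :
    q0 = 0 ∧ q1 = 0 ∧ q2 = 0 ∧ q3 = 0 ∧ q4 = 0 := by
  have h' := congrArg (algebraMap (𝓞 L) L) h
  have := lin_Q q0 q1 q2 q3 q4 (by simpa [a_coe] using h')
  exact_mod_cast this

theorem int_rep (z : 𝓞 L) : ∃ q0 q1 q2 q3 q4 : ℤ,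
    z = (q0 : 𝓞 L) + q1 * a + q2 * a ^ 2 + q3 * a ^ 3 + q4 * a ^ 4 := by
  have h := mem_adj z z.isIntegral_coe
  rw [Algebra.adjoin_singleton_eq_range_aeval] at h
  obtain ⟨p, hp⟩ := h
  have hm : (X ^ 5 - C 2 : ℤ[X]).Monic := monic_X_pow_sub_C 2 (by norm_num)
  have hd : (X ^ 5 - C 2 : ℤ[X]).natDegree = 5 := natDegree_X_pow_sub_C
  set r := p %ₘ (X ^ 5 - C 2) with hr
  have hrd : r.natDegree < 5 := by
    rw [← hd]; exact natDegree_modByMonic_lt _ hm (by intro h; rw [h] at hd; simp at hd)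
  have hz : aeval al r = (z : L) := by
    rw [← hp]
    have := modByMonic_add_div p (X ^ 5 - C 2 : ℤ[X])
    change aeval al r = aeval al p
    have h5 : aeval al (X ^ 5 - C 2 : ℤ[X]) = 0 := by
      rw [map_sub, map_pow, aeval_X, aeval_C, al5]; simp
    conv_rhs => rw [← this, map_add, map_mul, h5, zero_mul, add_zero]
  refine ⟨r.coeff 0, r.coeff 1, r.coeff 2, r.coeff 3, r.coeff 4, ?_⟩
  apply RingOfIntegers.ext
  rw [← hz, aeval_eq_sum_range' hrd]
  simp [Finset.sum_range_succ, a_coe]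

noncomputable def bas : Module.Basis (Fin 5) ℤ (𝓞 L) :=
  Module.Basis.mk (v := fun i : Fin 5 => a ^ (i : ℕ))
    (by
      rw [Fintype.linearIndependent_iff]
      intro g hg
      simp [Fin.sum_univ_succ] at hg
      have := lin_Z (g 0) (g 1) (g 2) (g 3) (g 4) (by rw [← hg]; ring)
      intro i; fin_cases i <;> simp [this])
    (by
      rintro z -
      obtain ⟨q0, q1, q2, q3, q4, h⟩ := int_rep z
      rw [Submodule.mem_span_range_iff_exists_fun]
      refine ⟨![q0, q1, q2, q3, q4], ?_⟩
      rw [h]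
      simp [Fin.sum_univ_succ]; ring)

theorem bas_apply (i : Fin 5) : bas i = a ^ (i : ℕ) := by simp [bas]

theorem discr_L : discr L = 50000 := by
  rw [← NumberField.discr_eq_discr L bas]
  have h := Algebra.discr_localizationLocalization ℤ (Rₘ := ℚ) (nonZeroDivisors ℤ) L bas
  have h2 : Algebra.discr ℚ (bas.localizationLocalization ℚ (nonZeroDivisors ℤ) L) = Algebra.discr ℚ pb.basis := by
    rw [← Algebra.discr_reindex ℚ pb.basis (finCongr pb_dim)]
    congr 1
    ext i
    simp [Module.Basis.localizationLocalization_apply, bas_apply, pb_gen, a_coe]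
  rw [h2, discr_pb] at h
  have h3 : ((Algebra.discr ℤ bas : ℤ) : ℚ) = 50000 := by rw [h]; simp
  exact_mod_cast h3

theorem mink : (4 / Real.pi) ^ InfinitePlace.nrComplexPlaces L *
  ((Module.finrank ℚ L).factorial / (Module.finrank ℚ L) ^ (Module.finrank ℚ L) * √|(discr L : ℤ)|) < 14 := by
  rw [finrank_L, discr_L]
  have hc : InfinitePlace.nrComplexPlaces L ≤ 2 := by
    have := InfinitePlace.card_add_two_mul_card_eq_rank L
    rw [finrank_L] at this
    omega
  have hpi := Real.pi_gt_d4
  have hpi4 : 1 ≤ 4 / Real.pi := by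
    rw [le_div_iff₀ Real.pi_pos]; linarith [Real.pi_le_four]
  have h1 : (4 / Real.pi) ^ InfinitePlace.nrComplexPlaces L ≤ (4 / 3.1415) ^ 2 := by
    calc (4 / Real.pi) ^ InfinitePlace.nrComplexPlaces L ≤ (4 / Real.pi) ^ 2 := pow_le_pow_right₀ hpi4 hc
      _ ≤ _ := by gcongr
  have h2 : √|((50000 : ℤ) : ℝ)| ≤ 223.61 := by
    rw [Real.sqrt_le_left (by norm_num)]; norm_num
  have h3 : ((Nat.factorial 5 : ℕ) : ℝ) = 120 := by norm_num [Nat.factorial]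
  rw [h3]
  calc _ ≤ (4 / 3.1415 : ℝ) ^ 2 * (120 / (5:ℕ) ^ 5 * 223.61) := by
        gcongr
    _ < 14 := by norm_num


theorem span_gen (P : Ideal (𝓞 L)) (hP : P ≠ ⊤) (g w w' : 𝓞 L) (m : ℤ) (p : ℕ) (hp : p.Prime)
    (h1 : a - m = g * w) (h2 : (p : 𝓞 L) = g * w') (hg : g ∈ P) : Submodule.IsPrincipal P := by
  refine ⟨⟨g, ?_⟩⟩
  apply le_antisymm
  · intro z hz
    obtain ⟨q0, q1, q2, q3, q4, h⟩ := int_rep z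
    set N : ℤ := q0 + q1 * m + q2 * m ^ 2 + q3 * m ^ 3 + q4 * m ^ 4 with hN
    have hzN : ∃ t, z = N + g * t := by
      refine ⟨w * (q1 + q2 * (a + m) + q3 * (a ^ 2 + a * m + m ^ 2)
        + q4 * (a ^ 3 + a ^ 2 * m + a * m ^ 2 + m ^ 3)), ?_⟩
      rw [← mul_assoc, ← h1, h, hN]; push_cast; ring
    obtain ⟨t, ht⟩ := hzN
    have hNP : (N : 𝓞 L) ∈ P := by
      have : (N : 𝓞 L) = z - g * t := by rw [ht]; ring
      rw [this]; exact sub_mem hz (P.mul_mem_right _ hg)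
    have hpP : (p : 𝓞 L) ∈ P := by rw [h2]; exact P.mul_mem_right _ hg
    have hdvd : (p : ℤ) ∣ N := by
      by_contra hnd
      have hcop : IsCoprime (p : ℤ) N := by
        rw [Prime.coprime_iff_not_dvd (Nat.prime_iff_prime_int.1 hp)]; exact hnd
      obtain ⟨u, v, huv⟩ := hcop
      apply hP
      rw [Ideal.eq_top_iff_one]
      have : (1 : 𝓞 L) = u * p + v * N := by exact_mod_cast huv.symm
      rw [this]
      exact add_mem (P.mul_mem_left _ hpP) (P.mul_mem_left _ hNP)
    obtain ⟨k, hk⟩ := hdvd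
    rw [Ideal.submodule_span_eq, Ideal.mem_span_singleton]
    refine ⟨w' * k + t, ?_⟩
    rw [ht, hk]; push_cast; rw [h2]; ring
  · rw [Submodule.span_singleton_le_iff_mem]; exact hg

theorem pid : IsPrincipalIdealRing (𝓞 L) := by
  apply RingOfIntegers.isPrincipalIdealRing_of_isPrincipal_of_norm_le_of_isPrime
  intro I hI hn
  have hlt : (Ideal.absNorm (I : Ideal (𝓞 L)) : ℝ) < 14 := lt_of_le_of_lt hn mink
  have hlt' : Ideal.absNorm (I : Ideal (𝓞 L)) < 14 := by exact_mod_cast hlt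
  have hI0 : (I : Ideal (𝓞 L)) ≠ ⊥ := nonZeroDivisors.coe_ne_zero I
  generalize (I : Ideal (𝓞 L)) = P at *
  have hmax : P.IsMaximal := hI.isMaximal hI0
  let := Ideal.Quotient.field P
  have hfin : Finite (𝓞 L ⧸ P) := Ideal.finiteQuotientOfFreeOfNeBot P hI0
  let : Fintype (𝓞 L ⧸ P) := Fintype.ofFinite _
  have hcard : Fintype.card (𝓞 L ⧸ P) = Ideal.absNorm P := by
    rw [Ideal.absNorm_apply, Submodule.cardQuot_apply, Nat.card_eq_fintype_card]
  set x : 𝓞 L ⧸ P := Ideal.Quotient.mk P a with hx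
  have hx5 : x ^ 5 = 2 := by rw [hx, ← map_pow, a5]; rfl
  have hq0 : ((Ideal.absNorm P : ℕ) : 𝓞 L ⧸ P) = 0 := by rw [← hcard]; exact Nat.cast_card_eq_zero _
  have hxq : x ^ (Ideal.absNorm P) = x := by rw [← hcard]; exact FiniteField.pow_card x
  have hge : 2 ≤ Ideal.absNorm P := by rw [← hcard]; exact Fintype.one_lt_card
  have ne : (1 : 𝓞 L ⧸ P) ≠ 0 := one_ne_zero
  have key2 : x = 0 → Submodule.IsPrincipal P := fun h =>
    span_gen P hmax.ne_top a 1 (a ^ 4) 0 2 (by norm_num) (by simp) (by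
      push_cast; linear_combination -a5) (Ideal.Quotient.eq_zero_iff_mem.1 h)
  have key3 : 1 + x = 0 → Submodule.IsPrincipal P := fun h =>
    span_gen P hmax.ne_top (1 + a) 1 (1 - a + a ^ 2 - a ^ 3 + a ^ 4) (-1) 3 (by norm_num) (by push_cast; ring) (by
      push_cast; linear_combination -a5) (Ideal.Quotient.eq_zero_iff_mem.1 (by simpa using h))
  have key5 : 1 + x ^ 2 = 0 → Submodule.IsPrincipal P := fun h =>
    span_gen P hmax.ne_top (1 + a ^ 2) (a - a ^ 3) (1 - 2 * a - a ^ 2 + 2 * a ^ 3 + a ^ 4) 2 5 (by norm_num) (by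
      push_cast; linear_combination a5) (by
      push_cast; linear_combination -(2 + a) * a5) (Ideal.Quotient.eq_zero_iff_mem.1 (by simpa using h))
  have key7 : 1 + x + x ^ 2 = 0 → Submodule.IsPrincipal P := fun h =>
    span_gen P hmax.ne_top (1 + a + a ^ 2) (-2 + a + a ^ 2 - 2 * a ^ 3 + a ^ 4) (3 - a - 2 * a ^ 2 + 3 * a ^ 3 - a ^ 4) 4 7
      (by norm_num) (by push_cast; linear_combination (1 - a) * a5) (by
      push_cast; linear_combination (-2 + a) * a5) (Ideal.Quotient.eq_zero_iff_mem.1 (by simpa using h))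
  have key13 : 1 - x ^ 2 + x ^ 4 = 0 → Submodule.IsPrincipal P := fun h =>
    span_gen P hmax.ne_top (1 - a ^ 2 + a ^ 4) (2 - 3 * a + a ^ 3 - 2 * a ^ 4) (-3 + 6 * a + a ^ 2 - 2 * a ^ 3 + 4 * a ^ 4) 6 13
      (by norm_num) (by push_cast; linear_combination (4 - 2 * a - a ^ 2 + 2 * a ^ 3) * a5) (by
      push_cast; linear_combination (-8 + 3 * a + 2 * a ^ 2 - 4 * a ^ 3) * a5) (Ideal.Quotient.eq_zero_iff_mem.1 (by simpa using h))
  have two : (2 : 𝓞 L ⧸ P) = 0 → Submodule.IsPrincipal P := fun h =>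
    key2 (by rw [h] at hx5; exact pow_eq_zero_iff (by norm_num) |>.1 hx5)
  by_cases h2 : (2 : 𝓞 L ⧸ P) = 0
  · exact two h2
  have hx0 : x ≠ 0 := by rintro h; rw [h] at hx5; apply h2; rw [← hx5]; simp
  generalize hN : Ideal.absNorm P = N at *
  have red : ∀ n, x ^ (n + 1) = x → x ^ n = 1 := by
    intro n hn
    rw [pow_succ] at hn
    exact mul_right_cancel₀ hx0 (by rw [hn, one_mul])
  interval_cases N
  · exact two (by exact_mod_cast hq0)
  · -- 3
    have h3 : (3 : 𝓞 L ⧸ P) = 0 := by exact_mod_cast hq0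
    have h := red 2 hxq
    apply key3
    linear_combination hx5 - (x ^ 3 + x) * h + h3
  · exact absurd (pow_eq_zero_iff (n := 2) (by norm_num) |>.1 (by push_cast at hq0; linear_combination hq0)) h2
  · -- 5
    have h3 : (5 : 𝓞 L ⧸ P) = 0 := by exact_mod_cast hq0
    apply key5
    have : x = 2 := by rw [← hx5, hxq]
    rw [this]; linear_combination h3
  · -- 6
    have h3 : (3 : 𝓞 L ⧸ P) = 0 := by
      apply mul_left_cancel₀ h2; push_cast at hq0; linear_combination hq0
    have h := red 5 hxq
    exact absurd (show (1 : 𝓞 L ⧸ P) = 0 by linear_combination h - hx5) ne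
  · -- 7
    have h7 : (7 : 𝓞 L ⧸ P) = 0 := by exact_mod_cast hq0
    have h := red 6 hxq
    have : x = 4 := by linear_combination 4 * h - 4 * x * hx5 - x * h7
    apply key7
    rw [this]; linear_combination 3 * h7
  · exact absurd (pow_eq_zero_iff (n := 3) (by norm_num) |>.1 (by push_cast at hq0; linear_combination hq0)) h2
  · -- 9
    have h3 : (3 : 𝓞 L ⧸ P) = 0 :=
      pow_eq_zero_iff (n := 2) (by norm_num) |>.1 (by push_cast at hq0; linear_combination hq0)
    have h := red 8 hxq
    apply key3
    linear_combination 3 * x * h3 - (x ^ 8 + 1) * h + x * (x ^ 10 + 2 * x ^ 5 + 4) * hx5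
  · -- 10
    have h3 : (5 : 𝓞 L ⧸ P) = 0 := by
      apply mul_left_cancel₀ h2; push_cast at hq0; linear_combination hq0
    have h := red 9 hxq
    have h4 : x = 4 := by linear_combination (-x) * h + (x ^ 5 + 2) * hx5
    rw [h4] at hx5
    exact absurd (show (2 : 𝓞 L ⧸ P) = 0 by linear_combination hx5 - 204 * h3) h2
  · -- 11
    have h3 : (11 : 𝓞 L ⧸ P) = 0 := by exact_mod_cast hq0
    have h := red 10 hxq
    exact absurd (show (1 : 𝓞 L ⧸ P) = 0 by linear_combination 4 * h - 4 * (x ^ 5 + 2) * hx5 - h3) ne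
  · -- 12
    have h3 : (3 : 𝓞 L ⧸ P) = 0 := by
      have : (2 * 2 : 𝓞 L ⧸ P) ≠ 0 := mul_ne_zero h2 h2
      apply mul_left_cancel₀ this; push_cast at hq0; linear_combination hq0
    have h := red 11 hxq
    have h1 : x = 1 := by linear_combination h - x * (x ^ 5 + 2) * hx5 - x * h3
    rw [h1] at hx5
    exact absurd (show (1 : 𝓞 L ⧸ P) = 0 by linear_combination -hx5) ne
  · -- 13
    have h3 : (13 : 𝓞 L ⧸ P) = 0 := by exact_mod_cast hq0
    have h := red 12 hxq
    have h4 : x ^ 2 = 10 := by linear_combination 10 * h - 10 * x ^ 2 * (x ^ 5 + 2) * hx5 - 3 * x ^ 2 * h3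
    apply key13
    linear_combination (x ^ 2 + 9) * h4 + 7 * h3
end G2

set_option linter.unusedSimpArgs false
namespace G2
open Polynomial NumberField

theorem nrReal_le : InfinitePlace.nrRealPlaces L ≤ 1 := by
  rw [← InfinitePlace.card_real_embeddings]
  rw [@Fintype.card_le_one_iff]
  rintro ⟨φ, hφ⟩ ⟨ψ, hψ⟩
  have key : ∀ φ : L →+* ℂ, ComplexEmbedding.IsReal φ → ∃ r : ℝ, φ al = r ∧ r ^ 5 = 2 := by
    intro φ hφ
    rw [ComplexEmbedding.isReal_iff] at hφ
    have h1 : (starRingEnd ℂ) (φ al) = φ al := by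
      conv_rhs => rw [← hφ]
      rfl
    obtain ⟨r, hr⟩ := Complex.conj_eq_iff_real.1 h1
    refine ⟨r, hr, ?_⟩
    have h2 : (φ al) ^ 5 = 2 := by rw [← map_pow, al5]; exact map_ofNat φ 2
    rw [hr] at h2
    exact_mod_cast h2
  obtain ⟨r, hr, hr5⟩ := key φ hφ
  obtain ⟨s, hs, hs5⟩ := key ψ hψ
  have hrs : r = s := by
    have : Odd 5 := by decide
    exact this.strictMono_pow.injective (by simp only [hr5, hs5])
  apply Subtype.ext
  change φ = ψ
  apply RingHom.ext
  intro z
  have : φ.toRatAlgHom = ψ.toRatAlgHom := by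
    apply AdjoinRoot.algHom_ext
    change φ al = ψ al
    rw [hr, hs, hrs]
  exact congrArg (fun g : L →ₐ[ℚ] ℂ => g z) this

theorem rank_le : Units.rank L ≤ 2 := by
  rw [Units.rank, InfinitePlace.card_eq_nrRealPlaces_add_nrComplexPlaces]
  have := InfinitePlace.card_add_two_mul_card_eq_rank L
  rw [finrank_L] at this
  have := nrReal_le
  omega

/-- Elements congruent to a polynomial in `a ^ 2` modulo two. -/
def Sq2 (z : 𝓞 L) : Prop := ∃ (s0 s1 s2 : ℤ) (t : 𝓞 L), z = s0 + s1 * a ^ 2 + s2 * a ^ 4 + 2 * t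

theorem Sq2.mul {x y : 𝓞 L} (hx : Sq2 x) (hy : Sq2 y) : Sq2 (x * y) := by
  obtain ⟨s0, s1, s2, t, rfl⟩ := hx
  obtain ⟨r0, r1, r2, q, rfl⟩ := hy
  refine ⟨s0 * r0, s0 * r1 + s1 * r0, s0 * r2 + s2 * r0 + s1 * r1, 
    t * (r0 + r1 * a ^ 2 + r2 * a ^ 4 + 2 * q) + (s0 + s1 * a ^ 2 + s2 * a ^ 4) * q + 
    (s1 * r2 + s2 * r1) * a + s2 * r2 * a ^ 3, ?_⟩
  push_cast
  linear_combination ((s1 * r2 + s2 * r1) * a + s2 * r2 * a ^ 3) * a5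

theorem Sq2.neg {x : 𝓞 L} (hx : Sq2 x) : Sq2 (-x) := by
  obtain ⟨s0, s1, s2, t, rfl⟩ := hx
  refine ⟨-s0, -s1, -s2, -t, ?_⟩
  push_cast; ring

theorem Sq2.sq (x : 𝓞 L) : Sq2 (x ^ 2) := by
  obtain ⟨q0, q1, q2, q3, q4, rfl⟩ := int_rep x
  refine ⟨q0 ^ 2, q1 ^ 2, q2 ^ 2, q0 * q1 * a + q0 * q2 * a ^ 2 + q0 * q3 * a ^ 3 + q0 * q4 * a ^ 4 +
    q1 * q2 * a ^ 3 + q1 * q3 * a ^ 4 + q1 * q4 * a ^ 5 + q2 * q3 * a ^ 5 + q2 * q4 * a ^ 6 + q3 * q4 * a ^ 7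
    + q3 ^ 2 * a + q4 ^ 2 * a ^ 3, ?_⟩
  push_cast
  linear_combination (q3 ^ 2 * a + q4 ^ 2 * a ^ 3) * a5

theorem Sq2.coeff {q0 q1 q2 q3 q4 : ℤ} (h : Sq2 ((q0 : 𝓞 L) + q1 * a + q2 * a ^ 2 + q3 * a ^ 3 + q4 * a ^ 4)) :
    2 ∣ q1 ∧ 2 ∣ q3 := by
  obtain ⟨s0, s1, s2, t, ht⟩ := h
  obtain ⟨t0, t1, t2, t3, t4, rfl⟩ := int_rep t
  have := lin_Z (q0 - s0 - 2 * t0) (q1 - 2 * t1) (q2 - s1 - 2 * t2) (q3 - 2 * t3) (q4 - s2 - 2 * t4) (by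
    push_cast
    linear_combination ht)
  omega

noncomputable def e1 : (𝓞 L)ˣ := ⟨a - 1, 1 + a + a ^ 2 + a ^ 3 + a ^ 4, by linear_combination a5, by linear_combination a5⟩
noncomputable def e2 : (𝓞 L)ˣ := ⟨-1 + a ^ 2 + a ^ 3, -1 + a ^ 2 - a ^ 3 + a ^ 4,
  by linear_combination (a ^ 2 ) * a5, by linear_combination (a ^ 2) * a5⟩

theorem e1_not : ¬ Sq2 (e1 : 𝓞 L) := by
  intro h
  have h' : (e1 : 𝓞 L) = ((-1 : ℤ) : 𝓞 L) + (1 : ℤ) * a + (0 : ℤ) * a ^ 2 + (0 : ℤ) * a ^ 3 + (0 : ℤ) * a ^ 4 := by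
    simp [e1]; ring
  rw [h'] at h
  have := h.coeff
  omega

theorem e2_not : ¬ Sq2 (e2 : 𝓞 L) := by
  intro h
  have h' : (e2 : 𝓞 L) = ((-1 : ℤ) : 𝓞 L) + (0 : ℤ) * a + (1 : ℤ) * a ^ 2 + (1 : ℤ) * a ^ 3 + (0 : ℤ) * a ^ 4 := by
    simp [e2]
  rw [h'] at h
  have := h.coeff
  omega

theorem e12_not : ¬ Sq2 ((e1 * e2 : (𝓞 L)ˣ) : 𝓞 L) := by
  intro h
  have h' : ((e1 * e2 : (𝓞 L)ˣ) : 𝓞 L) = ((1 : ℤ) : 𝓞 L) + (-1 : ℤ) * a + (-1 : ℤ) * a ^ 2 + (0 : ℤ) * a ^ 3 + (1 : ℤ) * a ^ 4 := by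
    simp [e2, e1]; ring
  rw [h'] at h
  have := h.coeff
  omega

theorem exists_cls : ∃ cls : (𝓞 L)ˣ → (Fin (Units.rank L) → ZMod 2),
    ∀ x y, cls x = cls y → ∃ v : (𝓞 L)ˣ, x * y = v ^ 2 ∨ x * y = - v ^ 2 := by
  choose ζe h using fun x => (Units.exist_unique_eq_mul_prod L x).exists
  refine ⟨fun x i => ((ζe x).2 i : ZMod 2), ?_⟩
  intro x y hxy
  have hpar : ∀ i, ∃ k : ℤ, (ζe x).2 i + (ζe y).2 i = 2 * k := by
    intro i
    have h1 := congrFun hxy i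
    simp only at h1
    have h2 := (ZMod.intCast_eq_intCast_iff_dvd_sub _ _ 2).1 h1
    obtain ⟨k, hk⟩ := h2
    exact ⟨k + (ζe x).2 i, by push_cast at hk; linarith⟩
  choose k hk using hpar
  have tor : ∀ z : Units.torsion L, (z : (𝓞 L)ˣ) = 1 ∨ (z : (𝓞 L)ˣ) = -1 := by
    intro z
    exact Units.torsion_eq_one_or_neg_one_of_odd_finrank (K := L) (by rw [finrank_L]; decide) z
  have hprod : x * y = ((ζe x).1 * (ζe y).1 : (𝓞 L)ˣ) * (∏ i, (Units.fundSystem L i) ^ (k i)) ^ 2 := by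
    conv_lhs => rw [h x, h y]
    rw [mul_mul_mul_comm, ← Finset.prod_mul_distrib, ← Finset.prod_pow]
    congr 1
    apply Finset.prod_congr rfl
    intro i _
    rw [← zpow_add, hk i, mul_comm, zpow_mul]
    rfl
  refine ⟨∏ i, (Units.fundSystem L i) ^ (k i), ?_⟩
  rw [hprod]
  rcases tor (ζe x).1 with h1 | h1 <;> rcases tor (ζe y).1 with h2 | h2 <;> rw [h1, h2] <;> simp

theorem unit_sq (u : (𝓞 L)ˣ) (hu : Sq2 (u : 𝓞 L)) : ∃ v : (𝓞 L)ˣ, u = v ^ 2 ∨ u = - v ^ 2 := by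
  obtain ⟨cls, hcls⟩ := exists_cls
  have hS : ∀ x y, cls x = cls y → Sq2 ((x * y : (𝓞 L)ˣ) : 𝓞 L) := by
    intro x y h
    obtain ⟨v, hv | hv⟩ := hcls x y h
    · rw [hv]; push_cast; exact Sq2.sq _
    · rw [hv]; push_cast; exact (Sq2.sq _).neg
  have hdiv : ∀ x y : (𝓞 L)ˣ, Sq2 (x : 𝓞 L) → Sq2 ((x * y : (𝓞 L)ˣ) : 𝓞 L) → Sq2 (y : 𝓞 L) := by
    intro x y hx hxy
    have : (y : 𝓞 L) = ((x * y : (𝓞 L)ˣ) : 𝓞 L) * (x * ((x⁻¹ : (𝓞 L)ˣ) : 𝓞 L) ^ 2) := by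
      have hinv : (x : 𝓞 L) * ((x⁻¹ : (𝓞 L)ˣ) : 𝓞 L) = 1 := x.mul_inv
      push_cast
      linear_combination (-y * (x : 𝓞 L) * ((x⁻¹ : (𝓞 L)ˣ) : 𝓞 L) - y) * hinv
    rw [this]
    exact hxy.mul (hx.mul (Sq2.sq _))
  have hsqu : ∀ x : (𝓞 L)ˣ, Sq2 ((x ^ 2 : (𝓞 L)ˣ) : 𝓞 L) := by
    intro x; push_cast; exact Sq2.sq _
  by_cases hu1 : cls u = cls 1
  · obtain ⟨v, hv⟩ := hcls u 1 hu1
    exact ⟨v, by simpa using hv⟩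
  exfalso
  -- five distinct classes
  have one : Sq2 ((1 : (𝓞 L)ˣ) : 𝓞 L) := ⟨1, 0, 0, 0, by simp⟩
  have h1 : cls 1 ≠ cls e1 := fun h => e1_not (by simpa using hS _ _ h)
  have h2 : cls 1 ≠ cls e2 := fun h => e2_not (by simpa using hS _ _ h)
  have h3 : cls 1 ≠ cls (e1 * e2) := fun h => e12_not (by simpa using hS _ _ h)
  have h4 : cls e1 ≠ cls e2 := fun h => e12_not (hS _ _ h)
  have h5 : cls e1 ≠ cls (e1 * e2) := fun h => e2_not (hdiv (e1 ^ 2) e2 (hsqu _) (by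
    rw [sq, mul_assoc]; exact hS _ _ h))
  have h6 : cls e2 ≠ cls (e1 * e2) := fun h => e1_not (hdiv (e2 ^ 2) e1 (hsqu _) (by
    have := hS _ _ h
    rwa [show e2 * (e1 * e2) = e2 ^ 2 * e1 by rw [sq, mul_comm e1 e2, mul_assoc]] at this))
  have h7 : cls u ≠ cls e1 := fun h => e1_not (hdiv u e1 hu (hS _ _ h))
  have h8 : cls u ≠ cls e2 := fun h => e2_not (hdiv u e2 hu (hS _ _ h))
  have h9 : cls u ≠ cls (e1 * e2) := fun h => e12_not (hdiv u _ hu (hS _ _ h))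
  have hcard : ({cls u, cls 1, cls e1, cls e2, cls (e1 * e2)} : Finset (Fin (Units.rank L) → ZMod 2)).card = 5 := by
    rw [Finset.card_insert_of_notMem, Finset.card_insert_of_notMem, Finset.card_insert_of_notMem,
      Finset.card_insert_of_notMem, Finset.card_singleton] <;> simp [*]
  have hle := Finset.card_le_univ ({cls u, cls 1, cls e1, cls e2, cls (e1 * e2)} : Finset (Fin (Units.rank L) → ZMod 2))
  rw [hcard] at hle
  simp at hle
  have : 2 ^ (Units.rank L) ≤ 2 ^ 2 := Nat.pow_le_pow_right (by norm_num) rank_le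
  omega
end G2

set_option linter.unusedSimpArgs false
namespace G2
open Polynomial NumberField

theorem a_dvd_iff (q0 q1 q2 q3 q4 : ℤ) :
    a ∣ (q0 : 𝓞 L) + q1 * a + q2 * a ^ 2 + q3 * a ^ 3 + q4 * a ^ 4 ↔ 2 ∣ q0 := by
  constructor
  · rintro ⟨t, ht⟩
    obtain ⟨t0, t1, t2, t3, t4, rfl⟩ := int_rep t
    have := lin_Z (q0 - 2 * t4) (q1 - t0) (q2 - t1) (q3 - t2) (q4 - t3) (by
      push_cast
      linear_combination ht + t4 * a5)
    omega
  · rintro ⟨k, rfl⟩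
    refine ⟨k * a ^ 4 + q1 + q2 * a + q3 * a ^ 2 + q4 * a ^ 3, ?_⟩
    push_cast
    linear_combination - k * a5

theorem a_prime : Prime a := by
  refine ⟨?_, ?_, ?_⟩
  · intro h
    have := a5
    rw [h] at this
    norm_num at this
  · intro h
    have h1 : a ∣ ((1 : ℤ) : 𝓞 L) + (0 : ℤ) * a + (0 : ℤ) * a ^ 2 + (0 : ℤ) * a ^ 3 + (0 : ℤ) * a ^ 4 := h.dvd
    rw [a_dvd_iff] at h1
    omega
  · intro x y hxy
    obtain ⟨x0, x1, x2, x3, x4, rfl⟩ := int_rep x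
    obtain ⟨y0, y1, y2, y3, y4, rfl⟩ := int_rep y
    rw [a_dvd_iff, a_dvd_iff]
    have : a ∣ ((x0 * y0 : ℤ) : 𝓞 L) + (0 : ℤ) * a + (0 : ℤ) * a ^ 2 + (0 : ℤ) * a ^ 3 + (0 : ℤ) * a ^ 4 := by
      have e : ((x0 * y0 : ℤ) : 𝓞 L) + (0 : ℤ) * a + (0 : ℤ) * a ^ 2 + (0 : ℤ) * a ^ 3 + (0 : ℤ) * a ^ 4 =
        (x0 + x1 * a + x2 * a ^ 2 + x3 * a ^ 3 + x4 * a ^ 4) * (y0 + y1 * a + y2 * a ^ 2 + y3 * a ^ 3 + y4 * a ^ 4)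
        - a * ((x1 + x2 * a ^ 1 + x3 * a ^ 2 + x4 * a ^ 3) * (y0 + y1 * a + y2 * a ^ 2 + y3 * a ^ 3 + y4 * a ^ 4)
          + x0 * (y1 + y2 * a + y3 * a ^ 2 + y4 * a ^ 3)) := by push_cast; ring
      rw [e]
      exact dvd_sub hxy (dvd_mul_right _ _)
    rw [a_dvd_iff] at this
    exact Int.prime_two.dvd_or_dvd this

noncomputable def p5 : 𝓞 L := 1 + a ^ 2

noncomputable def u5 : (𝓞 L)ˣ := ⟨-3 - 6 * a - a ^ 2 + 4 * a ^ 3 + 3 * a ^ 4, 1 + 4 * a + a ^ 2 + 2 * a ^ 3 + 2 * a ^ 4,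
  by linear_combination (2 + 9 * a + 14 * a ^ 2 + 6 * a ^ 3) * a5,
  by linear_combination (2 + 9 * a + 14 * a ^ 2 + 6 * a ^ 3) * a5⟩

theorem five_eq : p5 ^ 5 = 5 * ((u5⁻¹ : (𝓞 L)ˣ) : 𝓞 L) := by
  change (1 + a ^ 2) ^ 5 = 5 * (1 + 4 * a + a ^ 2 + 2 * a ^ 3 + 2 * a ^ 4)
  linear_combination (10 * a + 5 * a ^ 3 + a ^ 5 + 2) * a5

theorem five_eq' : (5 : 𝓞 L) = p5 ^ 5 * u5 := by
  rw [five_eq, mul_assoc, Units.inv_mul, mul_one]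

theorem p5_dvd_iff (q0 q1 q2 q3 q4 : ℤ) :
    p5 ∣ (q0 : 𝓞 L) + q1 * a + q2 * a ^ 2 + q3 * a ^ 3 + q4 * a ^ 4 ↔ 5 ∣ q0 + 2 * q1 + 4 * q2 + 8 * q3 + 16 * q4 := by
  constructor
  · rintro ⟨t, ht⟩
    obtain ⟨t0, t1, t2, t3, t4, rfl⟩ := int_rep t
    have := lin_Z (q0 - t0 - 2 * t3) (q1 - t1 - 2 * t4) (q2 - t2 - t0) (q3 - t3 - t1) (q4 - t4 - t2) (by
      unfold p5 at ht
      push_cast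
      linear_combination ht + (t3 + t4 * a) * a5)
    omega
  · rintro ⟨k, hk⟩
    have h5 : p5 ∣ 5 := ⟨p5 ^ 4 * u5, by rw [five_eq']; ring⟩
    have h2 : p5 ∣ a - 2 := ⟨a - a ^ 3, by unfold p5; linear_combination a5⟩
    have h3 : (q0 : 𝓞 L) = 5 * k - (2 * q1 + 4 * q2 + 8 * q3 + 16 * q4) := by
      have : q0 = 5 * k - (2 * q1 + 4 * q2 + 8 * q3 + 16 * q4) := by linarith
      exact_mod_cast this
    have e : (q0 : 𝓞 L) + q1 * a + q2 * a ^ 2 + q3 * a ^ 3 + q4 * a ^ 4 = 5 * k +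
      (a - 2) * (q1 + q2 * (a + 2) + q3 * (a ^ 2 + 2 * a + 4) + q4 * (a ^ 3 + 2 * a ^ 2 + 4 * a + 8)) := by
      rw [h3]; ring
    rw [e]
    exact dvd_add (h5.mul_right _) (h2.mul_right _)

theorem p5_prime : Prime p5 := by
  refine ⟨?_, ?_, ?_⟩
  · intro h
    have := five_eq'
    rw [h] at this
    norm_num at this
  · intro h
    have h1 : p5 ∣ ((1 : ℤ) : 𝓞 L) + (0 : ℤ) * a + (0 : ℤ) * a ^ 2 + (0 : ℤ) * a ^ 3 + (0 : ℤ) * a ^ 4 := h.dvd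
    rw [p5_dvd_iff] at h1
    omega
  · intro x y hxy
    obtain ⟨x0, x1, x2, x3, x4, rfl⟩ := int_rep x
    obtain ⟨y0, y1, y2, y3, y4, rfl⟩ := int_rep y
    rw [p5_dvd_iff, p5_dvd_iff]
    have h2 : p5 ∣ a - 2 := ⟨a - a ^ 3, by unfold p5; linear_combination a5⟩
    have key : ∀ z0 z1 z2 z3 z4 : ℤ, p5 ∣ (z0 : 𝓞 L) + z1 * a + z2 * a ^ 2 + z3 * a ^ 3 + z4 * a ^ 4 -
        ((z0 + 2 * z1 + 4 * z2 + 8 * z3 + 16 * z4 : ℤ) : 𝓞 L) := by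
      intro z0 z1 z2 z3 z4
      have e : (z0 : 𝓞 L) + z1 * a + z2 * a ^ 2 + z3 * a ^ 3 + z4 * a ^ 4 -
        ((z0 + 2 * z1 + 4 * z2 + 8 * z3 + 16 * z4 : ℤ) : 𝓞 L) =
         (a - 2) * (z1 + z2 * (a + 2) + z3 * (a ^ 2 + 2 * a + 4) + z4 * (a ^ 3 + 2 * a ^ 2 + 4 * a + 8)) := by
        push_cast; ring
      rw [e]; exact h2.mul_right _
    obtain ⟨s, hs⟩ := key x0 x1 x2 x3 x4
    obtain ⟨r, hr⟩ := key y0 y1 y2 y3 y4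
    obtain ⟨w, hw⟩ := hxy
    set X := x0 + 2 * x1 + 4 * x2 + 8 * x3 + 16 * x4
    set Y := y0 + 2 * y1 + 4 * y2 + 8 * y3 + 16 * y4
    have : p5 ∣ ((X * Y : ℤ) : 𝓞 L) + (0 : ℤ) * a + (0 : ℤ) * a ^ 2 + (0 : ℤ) * a ^ 3 + (0 : ℤ) * a ^ 4 := by
      refine ⟨w - s * (y0 + y1 * a + y2 * a ^ 2 + y3 * a ^ 3 + y4 * a ^ 4) - X * r, ?_⟩
      push_cast
      linear_combination hw - (y0 + y1 * a + y2 * a ^ 2 + y3 * a ^ 3 + y4 * a ^ 4) * hs - X * hr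
    rw [p5_dvd_iff] at this
    have h5 : Prime (5 : ℤ) := by norm_num
    apply h5.dvd_or_dvd
    simpa using this

/-- primes away from ten divide with even multiplicity -/
def EvenOut (z : 𝓞 L) : Prop := ∀ π : 𝓞 L, Prime π → ¬ π ∣ 10 → ∀ k : ℕ, π ^ (2 * k + 1) ∣ z → π ^ (2 * k + 2) ∣ z

theorem ten_eq : (10 : 𝓞 L) = a ^ 5 * (p5 ^ 5 * u5) := by rw [← five_eq', a5]; norm_num

theorem dvd_ten {π : 𝓞 L} (hπ : Prime π) (h : π ∣ 10) : Associated π a ∨ Associated π p5 := by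
  rw [ten_eq] at h
  rcases hπ.dvd_or_dvd h with h | h
  · left
    exact hπ.associated_of_dvd a_prime (hπ.dvd_of_dvd_pow h)
  · right
    rcases hπ.dvd_or_dvd h with h | h
    · exact hπ.associated_of_dvd p5_prime (hπ.dvd_of_dvd_pow h)
    · exact absurd (isUnit_of_dvd_unit h u5.isUnit) hπ.not_isUnit

theorem EvenOut.of_mul {ρ z : 𝓞 L} (hρ : ∀ π, Prime π → π ∣ ρ → π ∣ 10) (h : EvenOut (ρ * z)) : EvenOut z := by
  intro π hπ h10 k hk
  exact hπ.pow_dvd_of_dvd_mul_left _ (fun hd => h10 (hρ π hπ hd)) (h π hπ h10 k (hk.mul_left _))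

theorem EvenOut.of_sq_mul {ρ z : 𝓞 L} (hρ : Prime ρ) (h : EvenOut (ρ ^ 2 * z)) : EvenOut z := by
  intro π hπ h10 k hk
  by_cases hd : π ∣ ρ
  · have has := hπ.associated_of_dvd hρ hd
    have h1 : π ^ (2 * (k + 1) + 1) ∣ ρ ^ 2 * z := by
      rw [show 2 * (k + 1) + 1 = 2 + (2 * k + 1) by ring, pow_add]
      exact mul_dvd_mul (pow_dvd_pow_of_dvd hd 2) hk
    have h2 := h π hπ h10 _ h1
    rw [show 2 * (k + 1) + 2 = 2 + (2 * k + 2) by ring, pow_add] at h2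
    have h3 : π ^ 2 * π ^ (2 * k + 2) ∣ π ^ 2 * z := 
      h2.trans ((has.symm.pow_pow.mul_right z).dvd)
    exact (mul_dvd_mul_iff_left (pow_ne_zero 2 hπ.ne_zero)).1 h3
  · exact hπ.pow_dvd_of_dvd_mul_left _ (fun hd' => hd (hπ.dvd_of_dvd_pow hd')) (h π hπ h10 k (hk.mul_left _))

theorem fac (z : 𝓞 L) (hz : z ≠ 0) (h : EvenOut z) : 
    ∃ (u : (𝓞 L)ˣ) (i j : ℕ) (γ : 𝓞 L), z = u * a ^ i * p5 ^ j * γ ^ 2 := by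
  haveI := pid
  revert hz h
  refine WellFounded.induction (C := fun z : 𝓞 L => z ≠ 0 → EvenOut z → 
    ∃ (u : (𝓞 L)ˣ) (i j : ℕ) (γ : 𝓞 L), z = u * a ^ i * p5 ^ j * γ ^ 2) 
    (IsWellFounded.wf (r := DvdNotUnit (α := 𝓞 L))) z ?_
  intro z ih hz h
  by_cases hu : IsUnit z
  · obtain ⟨u, rfl⟩ := hu
    exact ⟨u, 0, 0, 1, by simp⟩
  obtain ⟨π, hπ, hd⟩ := WfDvdMonoid.exists_irreducible_factor hu hz
  replace hπ := hπ.prime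
  by_cases h10 : π ∣ 10
  · obtain ⟨w, rfl⟩ := hd
    have hw : w ≠ 0 := right_ne_zero_of_mul hz
    obtain ⟨u, i, j, γ, hγ⟩ := ih w ⟨hw, π, hπ.not_isUnit, by ring⟩ hw 
      (h.of_mul (fun ρ hρ hd => hd.trans h10))
    rcases dvd_ten hπ h10 with ⟨v, hv⟩ | ⟨v, hv⟩
    · refine ⟨v⁻¹ * u, i + 1, j, γ, ?_⟩
      have : π = a * ((v⁻¹ : (𝓞 L)ˣ) : 𝓞 L) := by rw [← hv, mul_assoc, Units.mul_inv, mul_one]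
      rw [this, hγ]; push_cast; ring
    · refine ⟨v⁻¹ * u, i, j + 1, γ, ?_⟩
      have : π = p5 * ((v⁻¹ : (𝓞 L)ˣ) : 𝓞 L) := by rw [← hv, mul_assoc, Units.mul_inv, mul_one]
      rw [this, hγ]; push_cast; ring
  · have h2 := h π hπ h10 0 (by simpa using hd)
    obtain ⟨w, rfl⟩ := h2
    simp only [mul_zero, zero_add] at *
    have hw : w ≠ 0 := right_ne_zero_of_mul hz
    obtain ⟨u, i, j, γ, hγ⟩ := ih w ⟨hw, π ^ 2, fun hh => hπ.not_isUnit (isUnit_of_dvd_unit (dvd_pow_self π two_ne_zero) hh), by ring⟩ hw 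
      (h.of_sq_mul hπ)
    exact ⟨u, i, j, π * γ, by rw [hγ]; ring⟩

theorem Sq2.add_two {x : 𝓞 L} (hx : Sq2 x) (t : 𝓞 L) : Sq2 (x + 2 * t) := by
  obtain ⟨s0, s1, s2, t', rfl⟩ := hx
  exact ⟨s0, s1, s2, t' + t, by ring⟩

/-- eighth powers of odd elements are one modulo two -/
theorem pow8 (g : 𝓞 L) (hg : ¬ a ∣ g) : ∃ t, g ^ 8 = 1 + 2 * t := by
  obtain ⟨q0, q1, q2, q3, q4, rfl⟩ := int_rep g
  rw [a_dvd_iff] at hg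
  obtain ⟨k, hk⟩ : ∃ k, q0 = 1 + 2 * k := ⟨q0 / 2, by omega⟩
  have hsq : ∀ x y : 𝓞 L, ∃ t, (x + a * y + 2 * t) = 0 → True := fun x y => ⟨0, fun _ => trivial⟩
  set m : 𝓞 L := q1 + q2 * a + q3 * a ^ 2 + q4 * a ^ 3 with hm
  have e : (q0 : 𝓞 L) + q1 * a + q2 * a ^ 2 + q3 * a ^ 3 + q4 * a ^ 4 = 1 + a * m + 2 * k := by
    rw [hk, hm]; push_cast; ring
  rw [e]
  refine ⟨4 * (1 + a * m) ^ 7 * 2 * k + 56 * (1 + a * m) ^ 6 * k ^ 2 + 224 * (1 + a * m) ^ 5 * k ^ 3 + 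
    560 * (1 + a * m) ^ 4 * k ^ 4 + 896 * (1 + a * m) ^ 3 * k ^ 5 + 896 * (1 + a * m) ^ 2 * k ^ 6 + 
    512 * (1 + a * m) * k ^ 7 + 128 * k ^ 8 + 
    (4 * (a * m) + 14 * (a * m) ^ 2 + 28 * (a * m) ^ 3 + 35 * (a * m) ^ 4 + 28 * (a * m) ^ 5 + 14 * (a * m) ^ 6 + 4 * (a * m) ^ 7)
    + a ^ 3 * m ^ 8, ?_⟩
  linear_combination a ^ 3 * m ^ 8 * a5

theorem sq2_cancel {z g : 𝓞 L} {u : 𝓞 L} (hg : ¬ a ∣ g) (hz : Sq2 z) (h : z = u * g ^ 2) : Sq2 u := by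
  obtain ⟨t, ht⟩ := pow8 g hg
  have : u = z * (g ^ 3) ^ 2 + 2 * (- u * t) := by
    linear_combination - u * ht - h * g ^ 6
  rw [this]
  exact (hz.mul (Sq2.sq _)).add_two _

theorem classN (z : 𝓞 L) (hz : Sq2 z) (ha : ¬ a ∣ z) (h : EvenOut z) :
    ∃ (n : ℤ) (γ : 𝓞 L), (n = 1 ∨ n = -1 ∨ n = 5 ∨ n = -5) ∧ z * p5 ^ 8 = n * γ ^ 2 := by
  obtain ⟨u, i, j, γ, hγ⟩ := fac z (by rintro rfl; exact ha (dvd_zero _)) h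
  have hi : i = 0 := by
    by_contra hi
    apply ha
    rw [hγ]
    exact (((dvd_pow_self a hi).mul_left _).mul_right _).mul_right _
  have hp5 : ¬ a ∣ p5 := by
    intro h
    have h1 : a ∣ ((1 : ℤ) : 𝓞 L) + (0 : ℤ) * a + (1 : ℤ) * a ^ 2 + (0 : ℤ) * a ^ 3 + (0 : ℤ) * a ^ 4 := by
      simpa [p5] using h
    rw [a_dvd_iff] at h1
    omega
  subst hi
  have hag : ¬ a ∣ γ := fun hd => ha (by rw [hγ]; exact (hd.pow two_ne_zero).mul_left _)
  rcases Nat.even_or_odd' j with ⟨k, rfl | rfl⟩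
  · have hg : ¬ a ∣ p5 ^ k * γ := by
      intro hd
      rcases a_prime.dvd_or_dvd hd with hd | hd
      · exact hp5 (a_prime.dvd_of_dvd_pow hd)
      · exact hag hd
    have e : z = u * (p5 ^ k * γ) ^ 2 := by rw [hγ]; ring
    obtain ⟨v, hv | hv⟩ := unit_sq u (sq2_cancel hg hz e)
    · refine ⟨1, v * (p5 ^ k * γ) * p5 ^ 4, by simp, ?_⟩
      rw [e, hv]; push_cast; ring
    · refine ⟨-1, v * (p5 ^ k * γ) * p5 ^ 4, by simp, ?_⟩
      rw [e, hv]; push_cast; ring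
  · have hg : ¬ a ∣ p5 ^ k * γ := by
      intro hd
      rcases a_prime.dvd_or_dvd hd with hd | hd
      · exact hp5 (a_prime.dvd_of_dvd_pow hd)
      · exact hag hd
    have e : z * p5 ^ 4 = 5 * ((u * u5⁻¹ : (𝓞 L)ˣ) : 𝓞 L) * (p5 ^ k * γ) ^ 2 := by
      rw [hγ]; push_cast
      linear_combination (u * p5 ^ (2 * k) * γ ^ 2) * five_eq
    have hs : Sq2 (z * p5 ^ 4) := hz.mul (by rw [show p5 ^ 4 = (p5 ^ 2) ^ 2 by ring]; exact Sq2.sq _)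
    have h5 := sq2_cancel hg hs e
    have h1 : Sq2 ((u * u5⁻¹ : (𝓞 L)ˣ) : 𝓞 L) := by
      have := h5.add_two (- 2 * ((u * u5⁻¹ : (𝓞 L)ˣ) : 𝓞 L))
      convert this using 1
      ring
    obtain ⟨v, hv | hv⟩ := unit_sq _ h1
    · refine ⟨5, v * (p5 ^ k * γ) * p5 ^ 2, by simp, ?_⟩
      rw [show z * p5 ^ 8 = z * p5 ^ 4 * p5 ^ 4 by ring, e, hv]; push_cast; ring
    · refine ⟨-5, v * (p5 ^ k * γ) * p5 ^ 2, by simp, ?_⟩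
      rw [show z * p5 ^ 8 = z * p5 ^ 4 * p5 ^ 4 by ring, e, hv]; push_cast; ring
end G2

set_option linter.unusedSimpArgs false
namespace G2
open Polynomial NumberField

noncomputable def F : ℤ[X] := -2 * X ^ 6 + X ^ 5 - 10 * X ^ 3 + 6 * X - 2

noncomputable def Nm (c : ℤ[X]) (e : ℤ) : ℤ[X] := c ^ 2 - c * C e - C e ^ 2 * F

structure Dv (A cs : ℤ[X]) (es : ℤ) : Prop where
  deg : A.natDegree = 2
  prim : A.IsPrimitive
  ne : es ≠ 0
  degc : cs.natDegree ≤ 3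
  dvd : A ∣ Nm cs es

def Mem (A cs : ℤ[X]) (es : ℤ) (c : ℤ[X]) (e : ℤ) : Prop := c.natDegree ≤ 3 ∧ A ∣ C es * c - C e * cs

theorem cancelC {A P : ℤ[X]} {k : ℤ} (hA : A.IsPrimitive) (hk : k ≠ 0) (h : A ∣ C k * P) : A ∣ P := by
  rw [IsPrimitive.Int.dvd_iff_map_cast_dvd_map_cast _ _ hA] at h ⊢
  rw [Polynomial.map_mul, Polynomial.map_C] at h
  have hu : IsUnit (C ((Int.castRingHom ℚ) k) : ℚ[X]) := by
    rw [isUnit_C, isUnit_iff_ne_zero]; simpa using hk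
  exact (hu.dvd_mul_left).1 h

theorem C_cancel {A P : ℤ[X]} {k : ℤ} (hA : A.IsPrimitive) (h : C k ∣ A * P) : C k ∣ P := by
  rw [← dvd_content_iff_C_dvd] at h ⊢
  rwa [content_mul, hA.content_eq_one, one_mul] at h

theorem Mem.nm {A cs : ℤ[X]} {es : ℤ} (hD : Dv A cs es) {c : ℤ[X]} {e : ℤ} (h : Mem A cs es c e) : A ∣ Nm c e := by
  obtain ⟨-, t, ht⟩ := h
  obtain ⟨s, hs⟩ := hD.dvd
  apply cancelC hD.prim hD.ne
  apply cancelC hD.prim hD.ne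
  refine ⟨t * (C es * c + C e * cs) - C e * t * C es + C e ^ 2 * s, ?_⟩
  unfold Nm at *
  linear_combination (C es * c + C e * cs - C e * C es) * ht + C e ^ 2 * hs

structure Rd (A c : ℤ[X]) (e : ℤ) : Prop extends Dv A c e where
  pos : 0 < e
  red : ∀ p : ℕ, p.Prime → (p : ℤ) ∣ e → ∀ b : (ZMod p)[X], b.natDegree ≤ 1 → 
    c.map (Int.castRingHom (ZMod p)) ≠ A.map (Int.castRingHom (ZMod p)) * b

theorem exists_lift {p : ℕ} (b : (ZMod p)[X]) (hb : b.natDegree ≤ 1) :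
    ∃ B : ℤ[X], B.natDegree ≤ 1 ∧ B.map (Int.castRingHom (ZMod p)) = b := by
  obtain ⟨x, hx⟩ := ZMod.intCast_surjective (b.coeff 0)
  obtain ⟨y, hy⟩ := ZMod.intCast_surjective (b.coeff 1)
  refine ⟨C y * X + C x, natDegree_linear_le, ?_⟩
  rw [eq_X_add_C_of_natDegree_le_one hb]
  simp only [Polynomial.map_add, Polynomial.map_mul, Polynomial.map_C, Polynomial.map_X, Int.coe_castRingHom, hx, hy]

theorem C_dvd_of_map {p : ℕ} {P : ℤ[X]} (h : P.map (Int.castRingHom (ZMod p)) = 0) : C (p : ℤ) ∣ P := by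
  rw [C_dvd_iff_dvd_coeff]
  intro i
  have := congrArg (fun Q => Q.coeff i) h
  simp only [coeff_map, coeff_zero, eq_intCast] at this
  exact (ZMod.intCast_zmod_eq_zero_iff_dvd _ _).1 this

theorem map_of_C_dvd {p : ℕ} {P : ℤ[X]} (h : C (p : ℤ) ∣ P) : P.map (Int.castRingHom (ZMod p)) = 0 := by
  obtain ⟨Q, rfl⟩ := h
  simp

theorem Mem.trans {A cs c c' : ℤ[X]} {es e e' : ℤ} (hA : A.IsPrimitive) (he : e ≠ 0) (h : Mem A cs es c e)
    (h' : Mem A c e c' e') : Mem A cs es c' e' := by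
  refine ⟨h'.1, ?_⟩
  obtain ⟨t, ht⟩ := h.2
  obtain ⟨s, hs⟩ := h'.2
  apply cancelC hA he
  exact ⟨C es * s + C e' * t, by linear_combination C es * hs + C e' * ht⟩

theorem exists_rd {A cs : ℤ[X]} {es : ℤ} (hD : Dv A cs es) : 
    ∃ c e, Rd A c e ∧ Mem A cs es c e ∧ ∀ c' e', Mem A c e c' e' → Mem A cs es c' e' := by
  classical
  have hex : ∃ n : ℕ, 0 < n ∧ ∃ c, Mem A cs es c n := by
    rcases lt_or_gt_of_ne hD.ne with h | h
    · refine ⟨(-es).toNat, by omega, -cs, by simpa using hD.degc, ?_⟩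
      rw [Int.toNat_of_nonneg (by omega)]
      simp
    · refine ⟨es.toNat, by omega, cs, hD.degc, ?_⟩
      rw [Int.toNat_of_nonneg (by omega)]
      simp
  set n := Nat.find hex with hn
  obtain ⟨hpos, c, hc⟩ := Nat.find_spec hex
  rw [← hn] at hpos hc
  have hn0 : (n : ℤ) ≠ 0 := by omega
  refine ⟨c, n, ⟨⟨hD.deg, hD.prim, hn0, hc.1, hc.nm hD⟩, by omega, ?_⟩, hc, fun c' e' h => hc.trans hD.prim hn0 h⟩
  intro p hp hpe b hb heq
  obtain ⟨B, hB, rfl⟩ := exists_lift b hb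
  have h1 : C (p : ℤ) ∣ c - A * B := C_dvd_of_map (by simp [heq])
  obtain ⟨c2, hc2⟩ := h1
  obtain ⟨m, hm⟩ := Int.natCast_dvd_natCast.1 hpe
  have hp0 : (p : ℤ) ≠ 0 := by exact_mod_cast hp.ne_zero
  have hm0 : 0 < m := Nat.pos_of_ne_zero (by rintro rfl; omega)
  have hlt : m < n := by rw [hm]; nlinarith [hp.two_le]
  refine Nat.find_min hex hlt ⟨hm0, c2, ?_, ?_⟩
  · have : (C (p : ℤ) * c2).natDegree ≤ 3 := by
      rw [← hc2]
      refine (natDegree_sub_le _ _).trans (max_le hc.1 (natDegree_mul_le.trans ?_))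
      have := hD.deg
      omega
    rwa [natDegree_C_mul hp0] at this
  · apply cancelC hD.prim hp0
    obtain ⟨t, ht⟩ := hc.2
    refine ⟨t - C es * B, ?_⟩
    have : (C (n : ℤ) : ℤ[X]) = C (p : ℤ) * C (m : ℤ) := by rw [← C_mul]; congr 1; exact_mod_cast hm
    linear_combination ht - C es * hc2 + this * cs

/-! coefficient forms -/
theorem form2 {R : Type*} [Semiring R] {A : R[X]} (h : A.natDegree ≤ 2) : 
    A = C (A.coeff 0) + C (A.coeff 1) * X + C (A.coeff 2) * X ^ 2 := by
  conv_lhs => rw [A.as_sum_range' 3 (by omega)]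
  simp [Finset.sum_range_succ, ← C_mul_X_pow_eq_monomial]

theorem form3 {R : Type*} [Semiring R] {A : R[X]} (h : A.natDegree ≤ 3) : 
    A = C (A.coeff 0) + C (A.coeff 1) * X + C (A.coeff 2) * X ^ 2 + C (A.coeff 3) * X ^ 3 := by
  conv_lhs => rw [A.as_sum_range' 4 (by omega)]
  simp [Finset.sum_range_succ, ← C_mul_X_pow_eq_monomial]

theorem form4 {R : Type*} [Semiring R] {A : R[X]} (h : A.natDegree ≤ 4) : 
    A = C (A.coeff 0) + C (A.coeff 1) * X + C (A.coeff 2) * X ^ 2 + C (A.coeff 3) * X ^ 3 + C (A.coeff 4) * X ^ 4 := by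
  conv_lhs => rw [A.as_sum_range' 5 (by omega)]
  simp [Finset.sum_range_succ, ← C_mul_X_pow_eq_monomial]

theorem lin7 {R : Type*} [CommRing R] {k0 k1 k2 k3 k4 k5 k6 : R} (h : (C k0 + C k1 * X + C k2 * X ^ 2 + C k3 * X ^ 3 + C k4 * X ^ 4
    + C k5 * X ^ 5 + C k6 * X ^ 6 : R[X]) = 0) : k0 = 0 ∧ k1 = 0 ∧ k2 = 0 ∧ k3 = 0 ∧ k4 = 0 ∧ k5 = 0 ∧ k6 = 0 := by
  have := fun i => congrArg (fun P => coeff P i) h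
  have h0 := this 0
  have h1 := this 1
  have h2 := this 2
  have h3 := this 3
  have h4 := this 4
  have h5 := this 5
  have h6 := this 6
  simp [coeff_X, coeff_C] at h0 h1 h2 h3 h4 h5 h6
  exact ⟨h0, h1, h2, h3, h4, h5, h6⟩

theorem natDegree_F : F.natDegree ≤ 6 := by unfold F; compute_degree

theorem natDegree_Nm {c : ℤ[X]} {e : ℤ} (hc : c.natDegree ≤ 3) : (Nm c e).natDegree ≤ 6 := by
  unfold Nm
  refine (natDegree_sub_le _ _).trans (max_le ((natDegree_sub_le _ _).trans (max_le ?_ ?_)) ?_)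
  · exact natDegree_pow_le.trans (by omega)
  · exact natDegree_mul_le.trans (by simp; omega)
  · exact natDegree_mul_le.trans (by
      have := natDegree_F
      rw [← C_pow, natDegree_C]; omega)

theorem deg_of_mul {A Q P : ℤ[X]} {n : ℕ} (hA : A.natDegree = 2) (h : P = A * Q) (hP : P.natDegree ≤ n + 2) :
    Q.natDegree ≤ n := by
  by_cases hQ : Q = 0
  · simp [hQ]
  rw [h, natDegree_mul (by rintro rfl; simp at hA) hQ] at hP
  omega

/-- coefficient equations of the norm -/
theorem nm_coeff {a0 a1 a2 c0 c1 c2 c3 e q0 q1 q2 q3 q4 : ℤ}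
    (h : Nm (C c0 + C c1 * X + C c2 * X ^ 2 + C c3 * X ^ 3) e = 
      (C a0 + C a1 * X + C a2 * X ^ 2) * (C q0 + C q1 * X + C q2 * X ^ 2 + C q3 * X ^ 3 + C q4 * X ^ 4)) :
    c0 ^ 2 - c0 * e + 2 * e ^ 2 = a0 * q0 ∧ 
    2 * c0 * c1 - c1 * e - 6 * e ^ 2 = a0 * q1 + a1 * q0 ∧
    2 * c0 * c2 + c1 ^ 2 - c2 * e = a0 * q2 + a1 * q1 + a2 * q0 ∧ 
    2 * c0 * c3 + 2 * c1 * c2 - c3 * e + 10 * e ^ 2 = a0 * q3 + a1 * q2 + a2 * q1 ∧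
    2 * c1 * c3 + c2 ^ 2 = a0 * q4 + a1 * q3 + a2 * q2 ∧
    2 * c2 * c3 - e ^ 2 = a1 * q4 + a2 * q3 ∧
    c3 ^ 2 + 2 * e ^ 2 = a2 * q4 := by
  have := lin7 (k0 := c0 ^ 2 - c0 * e + 2 * e ^ 2 - (a0 * q0))
    (k1 := 2 * c0 * c1 - c1 * e - 6 * e ^ 2 - (a0 * q1 + a1 * q0))
    (k2 := 2 * c0 * c2 + c1 ^ 2 - c2 * e - (a0 * q2 + a1 * q1 + a2 * q0)) 
    (k3 := 2 * c0 * c3 + 2 * c1 * c2 - c3 * e + 10 * e ^ 2 - (a0 * q3 + a1 * q2 + a2 * q1))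
    (k4 := 2 * c1 * c3 + c2 ^ 2 - (a0 * q4 + a1 * q3 + a2 * q2))
    (k5 := 2 * c2 * c3 - e ^ 2 - (a1 * q4 + a2 * q3))
    (k6 := c3 ^ 2 + 2 * e ^ 2 - (a2 * q4)) (by
      simp only [map_add, map_sub, map_mul, map_pow, map_ofNat]
      unfold Nm F at h
      linear_combination h)
  simp only [sub_eq_zero] at this
  exact this

theorem dvd_of_double {k : Type*} [Field k] {A Q c : k[X]} {θ : k} (h : c ^ 2 = A * Q) (hA : A.eval θ = 0) (hQ : Q.eval θ = 0)
    (hA0 : A ≠ 0) (hd : A.natDegree ≤ 2) : A ∣ c := by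
  have hc : c.eval θ = 0 := by
    have := congrArg (eval θ) h
    simpa [hA] using this
  obtain ⟨M, rfl⟩ := dvd_iff_isRoot.2 hA
  obtain ⟨N, rfl⟩ := dvd_iff_isRoot.2 hQ
  obtain ⟨d, rfl⟩ := dvd_iff_isRoot.2 hc
  have hx : (X - C θ : k[X]) ≠ 0 := X_sub_C_ne_zero θ
  have hM0 : M ≠ 0 := right_ne_zero_of_mul hA0
  have e : d ^ 2 = M * N := by
    apply mul_left_cancel₀ (pow_ne_zero 2 hx)
    linear_combination h
  apply mul_dvd_mul_left
  rw [natDegree_mul hx hM0, natDegree_X_sub_C] at hd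
  rcases Nat.lt_or_ge M.natDegree 1 with h0 | h1
  · exact (isUnit_iff_degree_eq_zero.2 (by rw [degree_eq_natDegree hM0]; norm_cast; omega)).dvd
  · have : Irreducible M := irreducible_of_degree_eq_one (by rw [degree_eq_natDegree hM0]; norm_cast; omega)
    exact this.prime.dvd_of_dvd_pow (e ▸ dvd_mul_right M N)

end G2

set_option linter.unusedSimpArgs false
namespace G2
open Polynomial NumberField

noncomputable def bet (A : ℤ[X]) : 𝓞 L := 
  ((A.coeff 2 + 2 * A.coeff 1 : ℤ) : 𝓞 L) + ((2 * A.coeff 2 : ℤ) : 𝓞 L) * a + ((- A.coeff 1 : ℤ) : 𝓞 L) * a ^ 2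
    + ((-2 * A.coeff 2 : ℤ) : 𝓞 L) * a ^ 3 + ((A.coeff 0 : ℤ) : 𝓞 L) * a ^ 4

theorem odd_pow_sq {π C m : 𝓞 L} (hπ : Prime π) (k : ℕ) (h : C ^ 2 = π ^ (2 * k + 1) * m) : π ∣ m := by
  induction k generalizing C with
  | zero =>
    simp only [mul_zero, zero_add, pow_one] at h
    obtain ⟨D, rfl⟩ := hπ.dvd_of_dvd_pow (h ▸ dvd_mul_right π m)
    refine ⟨D ^ 2, ?_⟩
    apply mul_left_cancel₀ hπ.ne_zero
    linear_combination - h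
  | succ k ih =>
    have : π ∣ C ^ 2 := by rw [h]; exact (dvd_pow_self π (by omega)).mul_right m
    obtain ⟨D, rfl⟩ := hπ.dvd_of_dvd_pow this
    apply ih (C := D)
    apply mul_left_cancel₀ (pow_ne_zero 2 hπ.ne_zero)
    rw [show 2 * (k + 1) + 1 = 2 + (2 * k + 1) by ring, pow_add] at h
    linear_combination h

theorem no_double {k : Type*} [Field k] {θ : k} (h5 : (5 : k) ≠ 0) (hq : 4 * θ ^ 5 + 20 * θ ^ 2 + 10 * θ - 7 = 0)
    (hf : -48 * θ ^ 5 + 20 * θ ^ 4 - 120 * θ ^ 2 + 24 = 0) : False := by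
  have : (5 : k) ^ 3 = 0 := by
    linear_combination (133 + 22 * θ - 432 * θ ^ 2 + 368 * θ ^ 3 - 192 * θ ^ 4) * hq +
      (44 - 49 * θ - 26 * θ ^ 2 + 24 * θ ^ 3 - 16 * θ ^ 4) * hf
  exact h5 (pow_eq_zero_iff (by norm_num) |>.1 this)

theorem evenOut_bet {A c : ℤ[X]} {e : ℤ} (hD : Rd A c e) : EvenOut (bet A) := by
  intro π hπ h10 kk hk
  by_contra hcon
  obtain ⟨β, hβ⟩ := hk
  have hβ' : ¬ π ∣ β := by
    rintro ⟨δ, rfl⟩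
    exact hcon ⟨δ, by rw [hβ]; ring⟩
  obtain ⟨Q, hQ⟩ := hD.dvd
  have dQ : Q.natDegree ≤ 4 := deg_of_mul hD.deg hQ (natDegree_Nm hD.degc)
  have hQ2 := hQ
  rw [form2 hD.deg.le, form3 hD.degc, form4 dQ] at hQ
  obtain ⟨n0, n1, n2, n3, n4, n5, n6⟩ := nm_coeff hQ
  have fA := form2 hD.deg.le
  have fQ := form4 dQ
  have fc := form3 hD.degc
  set a0 := A.coeff 0
  set a1 := A.coeff 1
  set a2 := A.coeff 2
  set c0 := c.coeff 0
  set c1 := c.coeff 1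
  set c2 := c.coeff 2
  set c3 := c.coeff 3
  set q0 := Q.coeff 0
  set q1 := Q.coeff 1
  set q2 := Q.coeff 2
  set q3 := Q.coeff 3
  set q4 := Q.coeff 4
  have hbet : bet A = a0 * (a ^ 2) ^ 2 + a1 * (a ^ 3 - 1) * a ^ 2 + a2 * (a ^ 3 - 1) ^ 2 := by
    change ((a2 + 2 * a1 : ℤ) : 𝓞 L) + ((2 * a2 : ℤ) : 𝓞 L) * a + ((- a1 : ℤ) : 𝓞 L) * a ^ 2
      + ((-2 * a2 : ℤ) : 𝓞 L) * a ^ 3 + ((a0 : ℤ) : 𝓞 L) * a ^ 4 = _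
    push_cast
    linear_combination (- a1 - a2 * a) * a5
  obtain ⟨y, hy⟩ : ∃ y, y = a ^ 2 := ⟨_, rfl⟩
  obtain ⟨x, hx⟩ : ∃ x, x = a ^ 3 - 1 := ⟨_, rfl⟩
  have hqh : 4 * x ^ 5 + 20 * x ^ 2 * y ^ 3 + 10 * x * y ^ 4 - 7 * y ^ 5 = 0 := by
    subst hx hy
    linear_combination (4 * a ^ 10 - 12 * a ^ 7 + 20 * a ^ 4 + 2 + a ^ 5 + 12 * a ^ 7 + 10 * a ^ 6 - 20 * a ^ 4 - 10 * a ^ 3) * a5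
  have hfh : -8 * x ^ 6 + 4 * x ^ 5 * y - 40 * x ^ 3 * y ^ 3 + 24 * x * y ^ 5 - 7 * y ^ 6 = 0 := by
    linear_combination (y - 2 * x) * hqh
  rw [← hy, ← hx] at hbet
  have m0 := congrArg (Int.cast (R := 𝓞 L)) n0
  have m1 := congrArg (Int.cast (R := 𝓞 L)) n1
  have m2 := congrArg (Int.cast (R := 𝓞 L)) n2
  have m3 := congrArg (Int.cast (R := 𝓞 L)) n3
  have m4 := congrArg (Int.cast (R := 𝓞 L)) n4
  have m5 := congrArg (Int.cast (R := 𝓞 L)) n5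
  have m6 := congrArg (Int.cast (R := 𝓞 L)) n6
  push_cast at m0 m1 m2 m3 m4 m5 m6
  have hsq : ((2 * c0 - e) * y ^ 3 + 2 * c1 * x * y ^ 2 + 2 * c2 * x ^ 2 * y + 2 * c3 * x ^ 3) ^ 2 = 
    4 * bet A * (q0 * y ^ 4 + q1 * x * y ^ 3 + q2 * x ^ 2 * y ^ 2 + q3 * x ^ 3 * y + q4 * x ^ 4) := by
    rw [hbet]
    linear_combination 4 * (m0 * y ^ 6 + m1 * x * y ^ 5 + m2 * x ^ 2 * y ^ 4 + m3 * x ^ 3 * y ^ 3 + m4 * x ^ 4 * y ^ 2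
      + m5 * x ^ 5 * y + m6 * x ^ 6) + e ^ 2 * hfh
  have h2π : ¬ π ∣ 2 := fun h => h10 (h.trans ⟨5, by norm_num⟩)
  have h5π : ¬ π ∣ 5 := fun h => h10 (h.trans ⟨2, by norm_num⟩)
  have haπ : ¬ π ∣ a := fun h => h2π (h.trans ⟨a ^ 4, by rw [← a5]; ring⟩)
  -- residue field
  have hprime : (Ideal.span {π}).IsPrime := (Ideal.span_singleton_prime hπ.ne_zero).2 hπ
  obtain ⟨k, _, φ, hφ⟩ : ∃ (k : Type) (_ : Field k) (φ : 𝓞 L →+* k), ∀ z, φ z = 0 ↔ π ∣ z := by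
    refine ⟨FractionRing (𝓞 L ⧸ Ideal.span {π}), inferInstance, 
      (algebraMap (𝓞 L ⧸ Ideal.span {π}) (FractionRing (𝓞 L ⧸ Ideal.span {π}))).comp (Ideal.Quotient.mk _), ?_⟩
    intro z
    rw [RingHom.comp_apply, map_eq_zero_iff _ (IsFractionRing.injective _ _), Ideal.Quotient.eq_zero_iff_mem,
      Ideal.mem_span_singleton]
  have ky : φ y ≠ 0 := by
    rw [Ne, hφ, hy]; exact fun h => haπ (hπ.dvd_of_dvd_pow h)
  have k2 : (2 : k) ≠ 0 := by
    have : φ 2 ≠ 0 := by rw [Ne, hφ]; exact h2π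
    rwa [map_ofNat] at this
  have k5 : (5 : k) ≠ 0 := by
    have : φ 5 ≠ 0 := by rw [Ne, hφ]; exact h5π
    rwa [map_ofNat] at this
  have kA : φ (bet A) = 0 := (hφ _).2 (by rw [hβ]; exact (dvd_pow_self π (by omega)).mul_right _)
  have kQ : φ (q0 * y ^ 4 + q1 * x * y ^ 3 + q2 * x ^ 2 * y ^ 2 + q3 * x ^ 3 * y + q4 * x ^ 4) = 0 := by
    rw [hφ]
    have h1 := odd_pow_sq hπ kk (hsq.trans (by rw [hβ]; rw [show ∀ P q : 𝓞 L, 4 * (P * β) * q = P * (2 * (2 * (β * q))) by intros; ring]))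
    rcases hπ.dvd_or_dvd h1 with h | h
    · exact absurd h h2π
    rcases hπ.dvd_or_dvd h with h | h
    · exact absurd h h2π
    rcases hπ.dvd_or_dvd h with h | h
    · exact absurd h hβ'
    · exact h
  have kC : φ ((2 * c0 - e) * y ^ 3 + 2 * c1 * x * y ^ 2 + 2 * c2 * x ^ 2 * y + 2 * c3 * x ^ 3) = 0 := by
    have := congrArg φ hsq
    rw [map_pow, map_mul, map_mul, kA, mul_zero, zero_mul] at this
    exact pow_eq_zero_iff (by norm_num) |>.1 this
  have kq := congrArg φ hqh
  obtain ⟨θ, hθ⟩ : ∃ θ, φ x = θ * φ y := ⟨φ x / φ y, by field_simp⟩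
  rw [hbet] at kA
  simp only [map_add, map_sub, map_mul, map_pow, map_ofNat, map_intCast, map_zero, hθ] at kA kQ kC kq
  replace kA : (a0 : k) + a1 * θ + a2 * θ ^ 2 = 0 := by
    apply (mul_eq_zero.1 (show φ y ^ 2 * _ = 0 by linear_combination kA)).resolve_left (pow_ne_zero _ ky)
  replace kQ : (q0 : k) + q1 * θ + q2 * θ ^ 2 + q3 * θ ^ 3 + q4 * θ ^ 4 = 0 := by
    apply (mul_eq_zero.1 (show φ y ^ 4 * _ = 0 by linear_combination kQ)).resolve_left (pow_ne_zero _ ky)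
  replace kC : (2 * c0 - e : k) + 2 * c1 * θ + 2 * c2 * θ ^ 2 + 2 * c3 * θ ^ 3 = 0 := by
    apply (mul_eq_zero.1 (show φ y ^ 3 * _ = 0 by linear_combination kC)).resolve_left (pow_ne_zero _ ky)
  replace kq : 4 * θ ^ 5 + 20 * θ ^ 2 + 10 * θ - 7 = 0 := by
    apply (mul_eq_zero.1 (show φ y ^ 5 * _ = 0 by linear_combination kq)).resolve_left (pow_ne_zero _ ky)
  by_cases he : (e : k) = 0
  · obtain ⟨p, hp⟩ := CharP.exists k
    have hpe : (p : ℤ) ∣ e := (CharP.intCast_eq_zero_iff k p e).1 he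
    have hpp : p.Prime := by
      rcases CharP.char_is_prime_or_zero k p with h | h
      · exact h
      · subst h
        have := hD.pos
        simp at hpe
        omega
    haveI : Fact p.Prime := ⟨hpp⟩
    have hcomp : (ZMod.castHom (dvd_refl p) k).comp (Int.castRingHom (ZMod p)) = Int.castRingHom k := RingHom.ext_int _ _
    have hN := congrArg (Polynomial.map (Int.castRingHom k)) hQ2
    have hAp : A.map (Int.castRingHom (ZMod p)) ≠ 0 := by
      intro h0
      have h1 := C_dvd_of_map h0
      have h2 := hD.prim _ h1
      have h3 : p = 1 := by simpa [Int.isUnit_iff_natAbs_eq] using h2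
      exact hpp.one_lt.ne' h3
    have hAk : A.map (Int.castRingHom k) ≠ 0 := by
      rw [← hcomp, ← Polynomial.map_map]
      rwa [Ne, Polynomial.map_eq_zero]
    have hsqk : (c.map (Int.castRingHom k)) ^ 2 = A.map (Int.castRingHom k) * Q.map (Int.castRingHom k) := by
      rw [← Polynomial.map_mul, ← hN]
      unfold Nm
      simp only [Polynomial.map_sub, Polynomial.map_mul, Polynomial.map_pow, map_C, Int.coe_castRingHom, he, C_0]
      ring
    have hdk : A.map (Int.castRingHom k) ∣ c.map (Int.castRingHom k) := by
      refine dvd_of_double (θ := θ) hsqk ?_ ?_ hAk (natDegree_map_le.trans hD.deg.le)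
      · rw [fA]; simpa using kA
      · rw [fQ]; simpa using kQ
    have hdp : A.map (Int.castRingHom (ZMod p)) ∣ c.map (Int.castRingHom (ZMod p)) := by
      rw [← hcomp, ← Polynomial.map_map, ← Polynomial.map_map] at hdk
      exact (map_dvd_map' _).1 hdk
    obtain ⟨b, hb⟩ := hdp
    refine hD.red p hpp hpe b ?_ hb
    by_cases hb0 : b = 0
    · simp [hb0]
    have hNp := congrArg (Polynomial.map (Int.castRingHom (ZMod p))) hQ2
    have hep : (e : ZMod p) = 0 := (ZMod.intCast_zmod_eq_zero_iff_dvd _ _).2 hpe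
    have hsqp : (c.map (Int.castRingHom (ZMod p))) ^ 2 = A.map (Int.castRingHom (ZMod p)) * Q.map (Int.castRingHom (ZMod p)) := by
      rw [← Polynomial.map_mul, ← hNp]
      unfold Nm
      simp only [Polynomial.map_sub, Polynomial.map_mul, Polynomial.map_pow, map_C, Int.coe_castRingHom, hep, C_0]
      ring
    rw [hb] at hsqp
    have hAb : A.map (Int.castRingHom (ZMod p)) * b ^ 2 = Q.map (Int.castRingHom (ZMod p)) := by
      apply mul_left_cancel₀ hAp
      linear_combination hsqp
    have hdeg := congrArg natDegree hAb
    rw [natDegree_mul hAp (pow_ne_zero 2 hb0), natDegree_pow] at hdeg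
    have hQd : (Q.map (Int.castRingHom (ZMod p))).natDegree ≤ 4 := natDegree_map_le.trans dQ
    have hA1 : 1 ≤ (A.map (Int.castRingHom (ZMod p))).natDegree := by
      by_contra hlt
      have h0 : (A.map (Int.castRingHom (ZMod p))).natDegree = 0 := by omega
      have h1 : (A.map (Int.castRingHom k)).natDegree = 0 := by
        rw [← hcomp, ← Polynomial.map_map, natDegree_map, h0]
      have h2 : (A.map (Int.castRingHom k)).eval θ = 0 := by rw [fA]; simpa using kA
      rw [eq_C_of_natDegree_eq_zero h1, eval_C] at h2
      apply hAk
      rw [eq_C_of_natDegree_eq_zero h1, h2, C_0]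
    omega
  · refine no_double k5 kq ?_
    have l1 := congrArg (Int.cast (R := k)) n1
    have l2 := congrArg (Int.cast (R := k)) n2
    have l3 := congrArg (Int.cast (R := k)) n3
    have l4 := congrArg (Int.cast (R := k)) n4
    have l5 := congrArg (Int.cast (R := k)) n5
    have l6 := congrArg (Int.cast (R := k)) n6
    push_cast at l1 l2 l3 l4 l5 l6
    have : (e : k) ^ 2 * (-48 * θ ^ 5 + 20 * θ ^ 4 - 120 * θ ^ 2 + 24) = 0 := by
      linear_combination -4 * (l1 + 2 * θ * l2 + 3 * θ ^ 2 * l3 + 4 * θ ^ 3 * l4 + 5 * θ ^ 4 * l5 + 6 * θ ^ 5 * l6)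
        + 2 * (2 * c1 + 4 * c2 * θ + 6 * c3 * θ ^ 2) * kC - 4 * (a1 + 2 * a2 * θ) * kQ 
        - 4 * (q1 + 2 * q2 * θ + 3 * q3 * θ ^ 2 + 4 * q4 * θ ^ 3) * kA
    exact (mul_eq_zero.1 this).resolve_left (pow_ne_zero 2 he)
end G2

set_option linter.unusedSimpArgs false
namespace G2
open Polynomial NumberField

noncomputable def xi : L := (al ^ 3 - 1) / al ^ 2
noncomputable def qQ : ℚ[X] := 4 * X ^ 5 + 20 * X ^ 2 + 10 * X - 7

theorem al_ne : al ≠ 0 := by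
  intro h
  have := al5
  rw [h] at this
  norm_num at this

theorem xi_mul : xi * al ^ 2 = al ^ 3 - 1 := by
  unfold xi; exact div_mul_cancel₀ _ (pow_ne_zero 2 al_ne)

theorem lin_xi {r0 r1 r2 r3 r4 : ℚ} (h : (r0 : L) + (r1 : L) * xi + (r2 : L) * xi ^ 2 + 
    (r3 : L) * xi ^ 3 + (r4 : L) * xi ^ 4 = 0) : r0 = 0 ∧ r1 = 0 ∧ r2 = 0 ∧ r3 = 0 ∧ r4 = 0 := by
  have hm := xi_mul
  have e := al5
  have h2 : (r0 : L) * (al ^ 2) ^ 4 + (r1 : L) * (al ^ 3 - 1) * (al ^ 2) ^ 3 + 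
    (r2 : L) * (al ^ 3 - 1) ^ 2 * (al ^ 2) ^ 2 + (r3 : L) * (al ^ 3 - 1) ^ 3 * (al ^ 2) +
    (r4 : L) * (al ^ 3 - 1) ^ 4 = 0 := by
    rw [← hm]; linear_combination (al ^ 2) ^ 4 * h
  have := lin_Q (4 * r2 + 6 * r3 + r4) (-2 * r1 + 4 * r3 + 12 * r4) (-4 * r2 - r3 + 4 * r4) (2 * r0 - 6 * r3 - 4 * r4)
    (2 * r1 + r2 - 8 * r4) (by
      push_cast
      linear_combination h2 - ((r0 : L) * al ^ 3 + (r1 : L) * (al ^ 4 - al) + (r2 : L) * (al ^ 5 + 2 - 2 * al ^ 2)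
        + (r3 : L) * (al ^ 6 + 2 * al - 3 * al ^ 3 + 3) + (r4 : L) * (al ^ 7 + 2 * al ^ 2 - 4 * al ^ 4 + 6 * al)) * e)
  obtain ⟨h0, h1, h2, h3, h4⟩ := this
  refine ⟨?_, ?_, ?_, ?_, ?_⟩ <;> linarith

theorem natDegree_qQ : qQ.natDegree = 5 := by unfold qQ; compute_degree!

theorem qQ_xi : aeval xi qQ = 0 := by
  have hm := xi_mul
  have e := al5
  have : (al ^ 2) ^ 5 * aeval xi qQ = 0 := by
    unfold qQ
    simp only [map_add, map_sub, map_mul, map_pow, aeval_X, map_ofNat]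
    have h2 : 4 * (al ^ 3 - 1) ^ 5 + 20 * (al ^ 3 - 1) ^ 2 * (al ^ 2) ^ 3 + 10 * (al ^ 3 - 1) * (al ^ 2) ^ 4 - 7 * (al ^ 2) ^ 5 = 0 := by
      linear_combination (4 * al ^ 10 - 12 * al ^ 7 + 20 * al ^ 4 + 2 + al ^ 5 + 12 * al ^ 7 + 10 * al ^ 6 - 20 * al ^ 4 - 10 * al ^ 3) * e
    rw [← hm] at h2
    linear_combination h2
  exact (mul_eq_zero.1 this).resolve_left (pow_ne_zero _ (pow_ne_zero _ al_ne))

theorem qdvd {P : ℚ[X]} (h : aeval xi P = 0) : qQ ∣ P := by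
  have hq0 : qQ ≠ 0 := by intro h0; have := natDegree_qQ; rw [h0] at this; simp at this
  rw [← EuclideanDomain.mod_eq_zero]
  have hlt : (P % qQ).natDegree ≤ 4 := by
    have := natDegree_mod_lt P (q := qQ) (by rw [natDegree_qQ]; norm_num)
    rw [natDegree_qQ] at this
    omega
  have hev : aeval xi (P % qQ) = 0 := by
    have := EuclideanDomain.div_add_mod P qQ
    have h2 := congrArg (aeval xi) this
    rw [map_add, map_mul, qQ_xi, zero_mul, zero_add, h] at h2
    exact h2
  have hf := form4 hlt
  rw [hf] at hev
  simp only [map_add, map_mul, map_pow, aeval_X, aeval_C] at hev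
  simp only [eq_ratCast] at hev
  obtain ⟨h0, h1, h2, h3, h4⟩ := lin_xi hev
  rw [hf, h0, h1, h2, h3, h4]
  simp

theorem bet_eq {A : ℤ[X]} (hA : A.natDegree ≤ 2) : algebraMap (𝓞 L) L (bet A) = al ^ 4 * aeval xi A := by
  have hm := xi_mul
  conv_rhs => rw [form2 hA]
  simp only [map_add, map_mul, map_pow, aeval_X, aeval_C]
  have hcast : algebraMap (𝓞 L) L (bet A) = ((A.coeff 2 + 2 * A.coeff 1 : ℤ) : L) + ((2 * A.coeff 2 : ℤ) : L) * al + ((- A.coeff 1 : ℤ) : L) * al ^ 2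
    + ((-2 * A.coeff 2 : ℤ) : L) * al ^ 3 + ((A.coeff 0 : ℤ) : L) * al ^ 4 := by
    unfold bet
    simp only [map_add, map_mul, map_pow, map_intCast]
    rfl
  rw [hcast]
  simp only [eq_intCast]
  push_cast
  have h1 : al ^ 4 * xi = (al ^ 3 - 1) * al ^ 2 := by linear_combination al ^ 2 * hm
  have h2 : al ^ 4 * xi ^ 2 = (al ^ 3 - 1) ^ 2 := by linear_combination (al ^ 2 * xi + al ^ 3 - 1) * hm
  linear_combination - (A.coeff 1 : L) * h1 - (A.coeff 2 : L) * h2 - (A.coeff 1 + A.coeff 2 * al : L) * al5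

theorem aeval_ne {A : ℤ[X]} (hA : A.natDegree ≤ 2) (h0 : A ≠ 0) : aeval xi A ≠ 0 := by
  intro h
  rw [form2 hA] at h
  simp only [map_add, map_mul, map_pow, aeval_X, aeval_C] at h
  simp only [eq_intCast] at h
  have := lin_xi (r0 := A.coeff 0) (r1 := A.coeff 1) (r2 := A.coeff 2) (r3 := 0) (r4 := 0) (by
    simpa using h)
  obtain ⟨h0', h1, h2, -, -⟩ := this
  apply h0
  rw [form2 hA]
  have e0 : A.coeff 0 = 0 := by exact_mod_cast h0'
  have e1 : A.coeff 1 = 0 := by exact_mod_cast h1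
  have e2 : A.coeff 2 = 0 := by exact_mod_cast h2
  rw [e0, e1, e2]
  simp

theorem p5_ne : algebraMap (𝓞 L) L p5 ≠ 0 := by
  intro h
  exact p5_prime.ne_zero ((map_eq_zero_iff _ (IsFractionRing.injective (𝓞 L) L)).1 h)

theorem dvd_a_ten {π : 𝓞 L} (h : π ∣ a ^ 4) : π ∣ 10 := by
  refine h.trans ⟨5 * a, ?_⟩
  linear_combination - 5 * a5

/-- coefficient facts for reduced divisors with even denominator -/
theorem even_coeff {A c : ℤ[X]} {e : ℤ} (hD : Rd A c e) (he : 2 ∣ e) (h2 : 2 ∣ A.coeff 2) : 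
    4 ∣ A.coeff 2 ∧ 4 ∣ A.coeff 1 ∧ ¬ 2 ∣ A.coeff 0 := by
  obtain ⟨Q, hQ⟩ := hD.dvd
  have dQ : Q.natDegree ≤ 4 := deg_of_mul hD.deg hQ (natDegree_Nm hD.degc)
  have hNp := congrArg (Polynomial.map (Int.castRingHom (ZMod 2))) hQ
  have hep : (e : ZMod 2) = 0 := (ZMod.intCast_zmod_eq_zero_iff_dvd _ _).2 (by exact_mod_cast he)
  have hsqp : (c.map (Int.castRingHom (ZMod 2))) ^ 2 = A.map (Int.castRingHom (ZMod 2)) * Q.map (Int.castRingHom (ZMod 2)) := by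
    rw [← Polynomial.map_mul, ← hNp]
    unfold Nm
    simp only [Polynomial.map_sub, Polynomial.map_mul, Polynomial.map_pow, map_C, Int.coe_castRingHom, hep, C_0]
    ring
  have hred := hD.red 2 Nat.prime_two (by exact_mod_cast he)
  have hQd : (Q.map (Int.castRingHom (ZMod 2))).natDegree ≤ 4 := natDegree_map_le.trans dQ
  have hA1 : (A.map (Int.castRingHom (ZMod 2))).natDegree ≤ 1 := by
    rw [natDegree_le_iff_coeff_eq_zero]
    intro N hN
    rw [coeff_map]
    rcases Nat.lt_or_ge 2 N with h | h
    · rw [coeff_eq_zero_of_natDegree_lt (by rw [hD.deg]; exact h)]; simp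
    · have : N = 2 := by omega
      subst this
      exact (ZMod.intCast_zmod_eq_zero_iff_dvd _ _).2 (by exact_mod_cast h2)
  have hAne : A.map (Int.castRingHom (ZMod 2)) ≠ 0 := by
    intro h0
    have h1 := C_dvd_of_map h0
    have h2 := hD.prim _ h1
    rw [Int.isUnit_iff] at h2
    norm_num at h2
  have hA0 : (A.map (Int.castRingHom (ZMod 2))).natDegree = 0 := by
    by_contra hne
    have h1 : (A.map (Int.castRingHom (ZMod 2))).natDegree = 1 := by omega
    have hirr : Irreducible (A.map (Int.castRingHom (ZMod 2))) := 
      irreducible_of_degree_eq_one (by rw [degree_eq_natDegree hAne, h1]; rfl)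
    obtain ⟨b, hb⟩ := hirr.prime.dvd_of_dvd_pow (hsqp ▸ dvd_mul_right _ _)
    refine hred b ?_ hb
    by_cases hb0 : b = 0
    · simp [hb0]
    rw [hb] at hsqp
    have hAb : A.map (Int.castRingHom (ZMod 2)) * b ^ 2 = Q.map (Int.castRingHom (ZMod 2)) := by
      apply mul_left_cancel₀ hAne
      linear_combination hsqp
    have hdeg := congrArg natDegree hAb
    rw [natDegree_mul hAne (pow_ne_zero 2 hb0), natDegree_pow] at hdeg
    omega
  have ha1 : 2 ∣ A.coeff 1 := by
    have : (A.map (Int.castRingHom (ZMod 2))).coeff 1 = 0 := coeff_eq_zero_of_natDegree_lt (by omega)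
    rw [coeff_map] at this
    exact_mod_cast (ZMod.intCast_zmod_eq_zero_iff_dvd _ _).1 this
  have hA1 : A.map (Int.castRingHom (ZMod 2)) = 1 := by
    rw [eq_C_of_natDegree_eq_zero hA0] at hAne ⊢
    have : ∀ z : ZMod 2, z ≠ 0 → z = 1 := by decide
    have h1 := this ((A.map (Int.castRingHom (ZMod 2))).coeff 0) (fun h => hAne (by rw [h, C_0]))
    rw [h1, C_1]
  have ha0 : ¬ 2 ∣ A.coeff 0 := by
    intro h
    have h1 := congrArg (fun P => coeff P 0) hA1
    simp only [coeff_map, coeff_one_zero] at h1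
    have : (Int.castRingHom (ZMod 2)) (A.coeff 0) = 0 := (ZMod.intCast_zmod_eq_zero_iff_dvd _ _).2 (by exact_mod_cast h)
    rw [this] at h1
    exact absurd h1 (by decide)
  have hc2 : ¬ 2 ∣ c.coeff 2 ∧ 2 ∣ c.coeff 3 := by
    rw [hA1, one_mul] at hsqp
    have hdeg := congrArg natDegree hsqp
    rw [natDegree_pow] at hdeg
    constructor
    · intro h
      refine hred (c.map (Int.castRingHom (ZMod 2))) ?_ (by rw [hA1, one_mul])
      rw [natDegree_le_iff_coeff_eq_zero]
      intro N hN
      rcases Nat.lt_or_ge 2 N with h' | h'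
      · exact coeff_eq_zero_of_natDegree_lt (by omega)
      · have : N = 2 := by omega
        subst this
        rw [coeff_map]
        exact (ZMod.intCast_zmod_eq_zero_iff_dvd _ _).2 (by exact_mod_cast h)
    · have : (c.map (Int.castRingHom (ZMod 2))).coeff 3 = 0 := coeff_eq_zero_of_natDegree_lt (by omega)
      rw [coeff_map] at this
      exact_mod_cast (ZMod.intCast_zmod_eq_zero_iff_dvd _ _).1 this
  rw [form2 hD.deg.le, form3 hD.degc, form4 dQ] at hQ
  obtain ⟨n0, n1, n2, n3, n4, n5, n6⟩ := nm_coeff hQ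
  obtain ⟨hc2, t, ht⟩ := hc2
  obtain ⟨e', rfl⟩ := he
  obtain ⟨A2, hA2⟩ := h2
  obtain ⟨b, hb⟩ := ha1
  rw [hA2] at n4 n5 n6
  rw [hb] at n4 n5
  rw [ht] at n4 n5 n6
  have hodd : ¬ 2 ∣ Q.coeff 4 := by
    intro h
    obtain ⟨r, hr⟩ := h
    have : 2 ∣ (c.coeff 2) ^ 2 := ⟨A.coeff 0 * r + b * Q.coeff 3 + A2 * Q.coeff 2 - 2 * c.coeff 1 * t, by rw [hr] at n4; linear_combination n4⟩
    exact hc2 (Int.prime_two.dvd_of_dvd_pow this)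
  have hA2e : 2 ∣ A2 := by
    have : 2 ∣ A2 * Q.coeff 4 := ⟨t ^ 2 + 2 * e' ^ 2, by linarith⟩
    exact (Int.prime_two.dvd_or_dvd this).resolve_right hodd
  have hbe : 2 ∣ b := by
    obtain ⟨s, rfl⟩ := hA2e
    have : 2 ∣ b * Q.coeff 4 := ⟨c.coeff 2 * t - e' ^ 2 - s * Q.coeff 3, by linarith⟩
    exact (Int.prime_two.dvd_or_dvd this).resolve_right hodd
  exact ⟨by omega, by omega, ha0⟩

theorem sq_value {A c : ℤ[X]} {e : ℤ} (hD : Rd A c e) (he : 2 ∣ e) : 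
    ∃ (n : ℤ) (γ : L), (n = 1 ∨ n = -1 ∨ n = 5 ∨ n = -5) ∧ aeval xi A = n * γ ^ 2 := by
  have hev := evenOut_bet hD
  have hbe := bet_eq hD.deg.le
  by_cases h2 : 2 ∣ A.coeff 2
  · obtain ⟨⟨s, hs⟩, ⟨t, ht⟩, ho⟩ := even_coeff hD he h2
    -- bet A = a ^ 4 * z
    obtain ⟨z, hz⟩ : ∃ z : 𝓞 L, z = ((A.coeff 0 : ℤ) : 𝓞 L) + ((2 * s + 4 * t : ℤ) : 𝓞 L) * a + ((4 * s : ℤ) : 𝓞 L) * a ^ 2 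
      + ((- 2 * t : ℤ) : 𝓞 L) * a ^ 3 + ((-4 * s : ℤ) : 𝓞 L) * a ^ 4 := ⟨_, rfl⟩
    have hbz : bet A = a ^ 4 * z := by
      rw [hz]; unfold bet; rw [hs, ht]; push_cast
      linear_combination (- (2 * s + 4 * t) - 4 * s * a + 2 * t * a ^ 2 + 4 * s * a ^ 3) * a5
    rw [hbz] at hev hbe
    obtain ⟨n, γ, hn, hγ⟩ := classN z ⟨A.coeff 0, 0, 0, (s + 2 * t) * a + 2 * s * a ^ 2 - t * a ^ 3 - 2 * s * a ^ 4, by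
      rw [hz]; push_cast; ring⟩ (by rw [hz, a_dvd_iff]; exact ho) 
      (hev.of_mul (fun π _ hd => dvd_a_ten hd))
    refine ⟨n, algebraMap (𝓞 L) L γ / (algebraMap (𝓞 L) L p5) ^ 4, hn, ?_⟩
    have h1 := congrArg (algebraMap (𝓞 L) L) hγ
    rw [map_mul, map_pow, show algebraMap (𝓞 L) L a = al from rfl] at hbe
    have h3 : aeval xi A = algebraMap (𝓞 L) L z := (mul_left_cancel₀ (pow_ne_zero 4 al_ne) hbe).symm
    rw [h3]
    simp only [map_mul, map_pow, map_intCast] at h1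
    have := p5_ne
    field_simp
    linear_combination h1
  · obtain ⟨n, γ, hn, hγ⟩ := classN (bet A) ⟨A.coeff 2, - A.coeff 1, A.coeff 0, A.coeff 1 + A.coeff 2 * a - A.coeff 2 * a ^ 3, by
      unfold bet; push_cast; ring⟩ (by unfold bet; rw [a_dvd_iff]; omega) hev
    refine ⟨n, algebraMap (𝓞 L) L γ / ((algebraMap (𝓞 L) L p5) ^ 4 * al ^ 2), hn, ?_⟩
    have h1 := congrArg (algebraMap (𝓞 L) L) hγ
    simp only [map_mul, map_pow, map_intCast] at h1
    rw [hbe] at h1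
    have := p5_ne
    have := al_ne
    field_simp
    linear_combination h1
end G2

set_option linter.unusedSimpArgs false
namespace G2
open Polynomial NumberField

theorem primLift {G : ℚ[X]} (hG : G ≠ 0) : ∃ (g : ℤ[X]) (k : ℚ), g.IsPrimitive ∧ k ≠ 0 ∧ 
    g.map (Int.castRingHom ℚ) = C k * G := by
  obtain ⟨b, hb⟩ := IsLocalization.integerNormalization_map_to_map (nonZeroDivisors ℤ) G
  set g := IsLocalization.integerNormalization (nonZeroDivisors ℤ) G
  have hb0 : (b : ℤ) ≠ 0 := nonZeroDivisors.coe_ne_zero b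
  have hb' : g.map (Int.castRingHom ℚ) = C ((b : ℤ) : ℚ) * G := by
    rw [show (Int.castRingHom ℚ) = algebraMap ℤ ℚ from rfl, hb]
    ext i; simp
  have hg0 : g ≠ 0 := by
    intro h
    rw [h, Polynomial.map_zero] at hb'
    have := mul_ne_zero (C_ne_zero.2 (show ((b : ℤ) : ℚ) ≠ 0 by exact_mod_cast hb0)) hG
    exact this hb'.symm
  have hc0 : g.content ≠ 0 := by rwa [Ne, content_eq_zero_iff]
  have hcq : (g.content : ℚ) ≠ 0 := by exact_mod_cast hc0
  refine ⟨g.primPart, (b : ℤ) / (g.content : ℚ), isPrimitive_primPart g, div_ne_zero (by exact_mod_cast hb0) hcq, ?_⟩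
  have h1 := congrArg (Polynomial.map (Int.castRingHom ℚ)) g.eq_C_content_mul_primPart
  rw [hb', Polynomial.map_mul, map_C] at h1
  apply mul_left_cancel₀ (C_ne_zero.2 hcq)
  rw [← mul_assoc, ← C_mul, mul_div_cancel₀ _ hcq, h1]
  rfl

noncomputable def pol (n : ℕ) : (Fin n → ℚ) →ₗ[ℚ] ℚ[X] := 
  (degreeLT ℚ n).subtype ∘ₗ ((degreeLTEquiv ℚ n).symm : (Fin n → ℚ) →ₗ[ℚ] degreeLT ℚ n)

theorem pol_deg (n : ℕ) (v : Fin (n + 1) → ℚ) : (pol (n + 1) v).natDegree ≤ n := by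
  have h : pol (n + 1) v ∈ degreeLT ℚ (n + 1) := ((degreeLTEquiv ℚ (n + 1)).symm v).2
  rw [mem_degreeLT] at h
  exact natDegree_le_of_degree_le (Order.le_of_lt_succ (by exact_mod_cast h))

theorem pol_inj (n : ℕ) (v : Fin n → ℚ) (h : pol n v = 0) : v = 0 := by
  have h1 : (degreeLTEquiv ℚ n).symm v = 0 := Subtype.ext h
  simpa using h1

theorem halfQ (A B : ℚ[X]) (k : ℚ) (hA : A.natDegree = 2) (γ : L) : ∃ (A' c : ℚ[X]) (e : ℚ), ¬ (A' = 0 ∧ c = 0 ∧ e = 0) ∧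
    A'.natDegree ≤ 2 ∧ c.natDegree ≤ 3 ∧ aeval xi c = γ * aeval xi A' ∧ A ∣ C k * c + C e * B := by
  have hA0 : A ≠ 0 := by rintro rfl; simp at hA
  let V := (Fin 3 → ℚ) × (Fin 4 → ℚ) × ℚ
  let T1 : V →ₗ[ℚ] L := ((aeval xi).toLinearMap ∘ₗ pol 4) ∘ₗ (LinearMap.fst ℚ _ _ ∘ₗ LinearMap.snd ℚ _ _)
    - (LinearMap.mulLeft ℚ γ ∘ₗ (aeval xi).toLinearMap ∘ₗ pol 3) ∘ₗ LinearMap.fst ℚ _ _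
  let r := AdjoinRoot.root A
  let T2 : V →ₗ[ℚ] AdjoinRoot A := (k • (aeval r).toLinearMap ∘ₗ pol 4) ∘ₗ (LinearMap.fst ℚ _ _ ∘ₗ LinearMap.snd ℚ _ _)
    + (LinearMap.toSpanSingleton ℚ (AdjoinRoot A) (aeval r B)) ∘ₗ (LinearMap.snd ℚ _ _ ∘ₗ LinearMap.snd ℚ _ _)
  let pbA := AdjoinRoot.powerBasis hA0
  haveI : FiniteDimensional ℚ (AdjoinRoot A) := pbA.finite
  haveI : FiniteDimensional ℚ L := pb.finite
  have hfA : Module.finrank ℚ (AdjoinRoot A) = 2 := by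
    rw [pbA.finrank, AdjoinRoot.powerBasis_dim, hA]
  have hlt : Module.finrank ℚ (L × AdjoinRoot A) < Module.finrank ℚ V := by
    rw [Module.finrank_prod, finrank_L, hfA]
    simp [V, Module.finrank_prod]
  have hker := LinearMap.ker_ne_bot_of_finrank_lt (f := T1.prod T2) hlt
  obtain ⟨⟨v, w, e⟩, hmem, hne⟩ := (Submodule.ne_bot_iff _).1 hker
  rw [LinearMap.mem_ker, LinearMap.prod_apply] at hmem
  have h1 : T1 (v, w, e) = 0 := congrArg Prod.fst hmem
  have h2 : T2 (v, w, e) = 0 := congrArg Prod.snd hmem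
  refine ⟨pol 3 v, pol 4 w, e, ?_, pol_deg 2 v, pol_deg 3 w, ?_, ?_⟩
  · rintro ⟨h3, h4, rfl⟩
    apply hne
    rw [pol_inj _ _ h3, pol_inj _ _ h4]
    rfl
  · have h1' : aeval xi (pol 4 w) - γ * aeval xi (pol 3 v) = 0 := h1
    linear_combination h1'
  · have h2' : k • aeval r (pol 4 w) + e • aeval r B = 0 := h2
    rw [← AdjoinRoot.mk_eq_zero, ← AdjoinRoot.aeval_eq]
    rw [map_add, map_mul, map_mul, aeval_C, aeval_C, ← Algebra.smul_def, ← Algebra.smul_def]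
    exact h2'

theorem sq_dvd {k : Type*} [Field k] {x y w z : k[X]} (hx : x ≠ 0) (hw : w ≠ 0) (hd : w.natDegree ≤ 1) 
    (h : x ^ 2 * y = w * z ^ 2) : x ∣ z := by
  classical
  obtain ⟨x', z', h1, h2, h3⟩ := extract_gcd x z
  set g := gcd x z
  have hg : g ≠ 0 := by intro h0; rw [h0, zero_mul] at h1; exact hx h1
  have hx' : x' ≠ 0 := by rintro rfl; rw [mul_zero] at h1; exact hx h1
  have h4 : x' ^ 2 * y = w * z' ^ 2 := by
    apply mul_left_cancel₀ (pow_ne_zero 2 hg)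
    rw [h1, h2] at h
    linear_combination h
  have hco : IsCoprime x' z' := (gcd_isUnit_iff _ _).1 h3
  have h5 : x' ^ 2 ∣ w := (hco.pow (m := 2) (n := 2)).dvd_of_dvd_mul_right (h4 ▸ dvd_mul_right _ _)
  have h6 := natDegree_le_of_dvd h5 hw
  rw [natDegree_pow] at h6
  have h7 : IsUnit x' := isUnit_iff_degree_eq_zero.2 (by rw [degree_eq_natDegree hx']; norm_cast; omega)
  rw [h1, h2]
  exact mul_dvd_mul_left g h7.dvd

noncomputable def mp (A : ℤ[X]) : ℚ[X] := A.map (Int.castRingHom ℚ)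

theorem four_F : 1 + 4 * mp F = (1 - 2 * X) * qQ := by
  unfold mp F qQ
  simp only [Polynomial.map_add, Polynomial.map_sub, Polynomial.map_mul, Polynomial.map_pow, Polynomial.map_X, Polynomial.map_neg,
    Polynomial.map_ofNat]
  ring

theorem aeval_mp (A : ℤ[X]) : aeval xi (mp A) = aeval xi A := by
  unfold mp
  rw [show (Int.castRingHom ℚ) = algebraMap ℤ ℚ from rfl, aeval_map_algebraMap]

theorem halfQ2 {A cs : ℤ[X]} {es : ℤ} (hD : Dv A cs es) {n : ℤ} (hn : n ≠ 0) {γ : L} (hA : aeval xi A = n * γ ^ 2) :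
    ∃ (A' c : ℚ[X]) (e : ℚ), ¬ (A' = 0 ∧ c = 0 ∧ e = 0) ∧
    A'.natDegree ≤ 2 ∧ c.natDegree ≤ 3 ∧ mp A ∣ C (es : ℚ) * c + C e * (C (es : ℚ) - 2 * mp cs) ∧ 
    C (n : ℚ) * (c ^ 2 - C e ^ 2 * (1 + 4 * mp F)) = mp A * A' ^ 2 := by
  have hdeg : (mp A).natDegree = 2 := by
    unfold mp
    rw [natDegree_map_eq_of_injective (RingHom.injective_int _), hD.deg]
  obtain ⟨A', c, e, h0, hd1, hd2, hγ, hdvd⟩ := halfQ (mp A) (C (es : ℚ) - 2 * mp cs) es hdeg γ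
  refine ⟨A', c, e, h0, hd1, hd2, hdvd, ?_⟩
  have hes : (es : ℚ) ≠ 0 := by exact_mod_cast hD.ne
  have hA0 : A ≠ 0 := hD.prim.ne_zero
  -- the value at xi vanishes
  have hev : aeval xi (C (n : ℚ) * c ^ 2 - mp A * A' ^ 2) = 0 := by
    simp only [map_sub, map_mul, map_pow, aeval_mp, hγ, hA, aeval_C]
    simp only [eq_ratCast]
    push_cast
    ring
  obtain ⟨l, hl⟩ := qdvd hev
  have hq0 : qQ ≠ 0 := by intro h0; have := natDegree_qQ; rw [h0] at this; simp at this
  have hld : l.natDegree ≤ 1 := by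
    by_cases hl0 : l = 0
    · simp [hl0]
    have h1 := congrArg natDegree hl
    rw [natDegree_mul hq0 hl0, natDegree_qQ] at h1
    have h2 : (C (n : ℚ) * c ^ 2 - mp A * A' ^ 2).natDegree ≤ 6 := by
      refine (natDegree_sub_le _ _).trans (max_le ?_ ?_)
      · exact natDegree_C_mul_le _ _ |>.trans (natDegree_pow_le.trans (by omega))
      · exact natDegree_mul_le.trans (by have := natDegree_pow_le (p := A') (n := 2); omega)
    omega
  -- compare modulo A
  obtain ⟨t, ht⟩ := hdvd
  obtain ⟨s, hs⟩ := hD.dvd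
  have hs' : (mp cs) ^ 2 - mp cs * C (es : ℚ) - C (es : ℚ) ^ 2 * mp F = mp A * mp s := by
    have := congrArg mp hs
    unfold Nm mp at this
    simp only [Polynomial.map_add, Polynomial.map_sub, Polynomial.map_mul, Polynomial.map_pow, map_C] at this
    exact this
  set m := l - C (n : ℚ) * C e ^ 2 * (1 - 2 * X) with hm
  have hmd : m.natDegree ≤ 1 := by
    refine (natDegree_sub_le _ _).trans (max_le hld ?_)
    rw [← C_pow, ← C_mul]
    refine (natDegree_C_mul_le _ _).trans ?_
    compute_degree
  have hdv : mp A ∣ C ((es : ℚ) ^ 2) * (qQ * m) := by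
    refine ⟨- C (es : ℚ) ^ 2 * A' ^ 2 + C (n : ℚ) * (t * (C (es : ℚ) * c - C e * (C (es : ℚ) - 2 * mp cs)) + 4 * C e ^ 2 * mp s), ?_⟩
    rw [hm, C_pow]
    have := four_F
    linear_combination - C (es : ℚ) ^ 2 * hl + C (n : ℚ) * (C (es : ℚ) * c - C e * (C (es : ℚ) - 2 * mp cs)) * ht +
      4 * C (n : ℚ) * C e ^ 2 * hs' + C (es : ℚ) ^ 2 * C (n : ℚ) * C e ^ 2 * this
  have hu : IsUnit (C ((es : ℚ) ^ 2) : ℚ[X]) := by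
    rw [isUnit_C, isUnit_iff_ne_zero]; exact pow_ne_zero 2 hes
  rw [hu.dvd_mul_left] at hdv
  obtain ⟨m', hm'⟩ := hdv
  have hev2 : aeval xi m' = 0 := by
    have h1 := congrArg (aeval xi) hm'
    rw [map_mul, map_mul, qQ_xi, zero_mul, aeval_mp] at h1
    exact (mul_eq_zero.1 h1.symm).resolve_left (aeval_ne hD.deg.le hA0)
  obtain ⟨m2, rfl⟩ := qdvd hev2
  have hm2 : m = mp A * m2 := by
    apply mul_left_cancel₀ hq0
    linear_combination hm'
  have hm0 : m = 0 := by
    by_contra hne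
    have := natDegree_le_of_dvd ⟨m2, hm2⟩ hne
    omega
  have hleq : l = C (n : ℚ) * C e ^ 2 * (1 - 2 * X) := by rw [hm] at hm0; exact sub_eq_zero.1 hm0
  rw [four_F]
  rw [hleq] at hl
  linear_combination hl

theorem halving {A cs : ℤ[X]} {es : ℤ} (hD : Dv A cs es) {n : ℤ} (hn : n ≠ 0) {γ : L} (hA : aeval xi A = n * γ ^ 2) :
    (∃ (A' c1 : ℤ[X]) (e1 u : ℤ), A'.natDegree = 2 ∧ A'.IsPrimitive ∧ e1 ≠ 0 ∧ Mem A cs es c1 e1 ∧ 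
      Nm c1 e1 = C u * (A * A' ^ 2) ∧ ¬ (C (2 : ℤ) ∣ c1 ∧ 2 ∣ e1)) ∨
    (∃ (M : ℤ[X]) (s : ℤ), M.natDegree = 1 ∧ M.IsPrimitive ∧ (s = 1 ∨ s = -1) ∧ A = C s * M ^ 2) := by
  obtain ⟨A', c, e, h0, hd1, hd2, hdvd, heq⟩ := halfQ2 hD hn hA
  have hnq : (n : ℚ) ≠ 0 := by exact_mod_cast hn
  have hAdeg : (mp A).natDegree = 2 := by
    unfold mp
    rw [natDegree_map_eq_of_injective (RingHom.injective_int _), hD.deg]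
  have hA0 : mp A ≠ 0 := by intro h; rw [h] at hAdeg; simp at hAdeg
  by_cases he : e = 0
  · right
    subst he
    simp only [C_0, ne_eq, OfNat.ofNat_ne_zero, not_false_eq_true, zero_pow, zero_mul, sub_zero] at heq
    have hA'0 : A' ≠ 0 := by
      rintro rfl
      apply h0
      simp [hn] at heq
      simp [heq]
    have hdv : A' ∣ c := sq_dvd (y := mp A) (w := C (n : ℚ)) hA'0 (C_ne_zero.2 hnq) (by simp) (by rw [heq]; ring)
    obtain ⟨m, rfl⟩ := hdv
    have hAm : mp A = C (n : ℚ) * m ^ 2 := by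
      apply mul_left_cancel₀ (pow_ne_zero 2 hA'0)
      linear_combination - heq
    have hm0 : m ≠ 0 := by rintro rfl; simp at hAm; exact hA0 hAm
    obtain ⟨M, k, hM, hk, hMk⟩ := primLift hm0
    have hMd : M.natDegree = 1 := by
      have h1 := congrArg natDegree hAm
      rw [natDegree_C_mul hnq, natDegree_pow, hAdeg] at h1
      have h2 := congrArg natDegree hMk
      rw [natDegree_C_mul hk, natDegree_map_eq_of_injective (RingHom.injective_int _)] at h2
      omega
    have hM2 : (M ^ 2).IsPrimitive := by rw [sq]; exact hM.mul hM
    have hd : M ^ 2 ∣ A := by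
      rw [IsPrimitive.Int.dvd_iff_map_cast_dvd_map_cast _ _ hM2]
      refine ⟨C ((n : ℚ) / k ^ 2), ?_⟩
      rw [Polynomial.map_pow, hMk]
      change mp A = _
      rw [hAm]
      have : C k ^ 2 * C ((n : ℚ) / k ^ 2) = C (n : ℚ) := by
        rw [← C_pow, ← C_mul, mul_div_cancel₀ _ (pow_ne_zero 2 hk)]
      linear_combination - m ^ 2 * this
    obtain ⟨S, hS⟩ := hd
    have hSd : S.natDegree = 0 := by
      have h1 := congrArg natDegree hS
      have hS0 : S ≠ 0 := by rintro rfl; exact hD.prim.ne_zero (by simpa using hS)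
      rw [natDegree_mul hM2.ne_zero hS0, natDegree_pow, hMd, hD.deg] at h1
      omega
    rw [eq_C_of_natDegree_eq_zero hSd] at hS
    refine ⟨M, S.coeff 0, hMd, hM, ?_, by rw [hS]; ring⟩
    have := hD.prim (S.coeff 0) ⟨M ^ 2, by rw [hS]; ring⟩
    exact Int.isUnit_iff.1 this
  · left
    have hA'0 : A'.coeff 2 ≠ 0 := by
      intro h2
      have hA'f := form2 hd1
      have hAf := form2 hAdeg.le
      have hcf := form3 hd2
      rw [h2, C_0, zero_mul, add_zero] at hA'f
      rw [hA'f, hAf, hcf, four_F] at heq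
      have h6 := congrArg (fun P => coeff P 6) heq
      generalize A'.coeff 0 = x0 at h6
      generalize A'.coeff 1 = x1 at h6
      generalize (mp A).coeff 0 = y0 at h6
      generalize (mp A).coeff 1 = y1 at h6
      generalize (mp A).coeff 2 = y2 at h6
      generalize c.coeff 0 = c0 at h6
      generalize c.coeff 1 = c1 at h6
      generalize c.coeff 2 = c2 at h6
      generalize c.coeff 3 = c3 at h6
      have e1 : ((C y0 + C y1 * X + C y2 * X ^ 2) * (C x0 + C x1 * X) ^ 2 : ℚ[X]) = C (y0 * x0 ^ 2) + C (y0 * (2 * x0 * x1) + y1 * x0 ^ 2) * X + 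
        C (y0 * x1 ^ 2 + y1 * (2 * x0 * x1) + y2 * x0 ^ 2) * X ^ 2 + C (y1 * x1 ^ 2 + y2 * (2 * x0 * x1)) * X ^ 3 + C (y2 * x1 ^ 2) * X ^ 4 := by
        simp only [map_add, map_mul, map_pow, map_ofNat]; ring
      have e2 : (C (n : ℚ) * ((C c0 + C c1 * X + C c2 * X ^ 2 + C c3 * X ^ 3) ^ 2 - C e ^ 2 * ((1 - 2 * X) * qQ)) : ℚ[X]) = 
        C (n * (c0 ^ 2 + 7 * e ^ 2)) + C (n * (2 * c0 * c1 - 24 * e ^ 2)) * X + C (n * (2 * c0 * c2 + c1 ^ 2)) * X ^ 2 + 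
        C (n * (2 * c0 * c3 + 2 * c1 * c2 + 40 * e ^ 2)) * X ^ 3 + C (n * (2 * c1 * c3 + c2 ^ 2)) * X ^ 4 + 
        C (n * (2 * c2 * c3 - 4 * e ^ 2)) * X ^ 5 + C (n * (c3 ^ 2 + 8 * e ^ 2)) * X ^ 6 := by
        unfold qQ
        simp only [map_add, map_sub, map_mul, map_pow, map_ofNat]; ring
      simp only [e1, e2] at h6
      simp only [coeff_add, coeff_C_mul, coeff_X_pow, coeff_X, coeff_C] at h6
      norm_num at h6
      rcases h6 with h6 | h6
      · exact hn h6
      · have : 0 < e ^ 2 := by positivity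
        nlinarith [sq_nonneg c3]
    have hA'ne : A' ≠ 0 := by rintro rfl; simp at hA'0
    have hA'd : A'.natDegree = 2 := le_antisymm hd1 (le_natDegree_of_ne_zero hA'0)
    obtain ⟨A1, k', hA1, hk', hA1k⟩ := primLift hA'ne
    have hA1d : A1.natDegree = 2 := by
      have h2 := congrArg natDegree hA1k
      rw [natDegree_C_mul hk', natDegree_map_eq_of_injective (RingHom.injective_int _)] at h2
      omega
    have hGne : (c + C e + C (2 * e) * X ^ 4 : ℚ[X]) ≠ 0 := by
      intro h
      have h4 := congrArg (fun P => coeff P 4) h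
      simp only [coeff_add, coeff_C_mul, coeff_X_pow, coeff_C, coeff_zero] at h4
      rw [coeff_eq_zero_of_natDegree_lt (by omega)] at h4
      norm_num at h4
      exact he h4
    obtain ⟨g, k, hg, hk, hgk⟩ := primLift hGne
    have hg4 : (g.coeff 4 : ℚ) = k * (2 * e) := by
      have h4 := congrArg (fun P => coeff P 4) hgk
      simp only [coeff_map, coeff_add, coeff_C_mul, coeff_X_pow, coeff_C] at h4
      rw [coeff_eq_zero_of_natDegree_lt (show c.natDegree < 4 by omega)] at h4
      norm_num at h4
      exact h4
    obtain ⟨e1, he1⟩ : ∃ e1, e1 = g.coeff 4 := ⟨_, rfl⟩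
    rw [← he1] at hg4
    obtain ⟨c1, hc1⟩ : ∃ c1, c1 = g - C e1 * X ^ 4 := ⟨_, rfl⟩
    have hc1q : mp c1 = C k * (c + C e) := by
      unfold mp
      rw [hc1, Polynomial.map_sub, hgk]
      simp only [Polynomial.map_mul, map_C, Polynomial.map_pow, map_X, Int.coe_castRingHom, hg4]
      simp only [C_mul]
      ring
    have hc1d : c1.natDegree ≤ 3 := by
      have : (mp c1).natDegree ≤ 3 := by
        rw [hc1q, natDegree_C_mul hk]
        exact (natDegree_add_le _ _).trans (max_le hd2 (by simp))
      unfold mp at this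
      rwa [natDegree_map_eq_of_injective (RingHom.injective_int _)] at this
    have he1q : (C ((e1 : ℤ) : ℚ) : ℚ[X]) = C k * (2 * C e) := by
      rw [hg4]; simp only [C_mul, map_ofNat]
    have hprod : (A * A1 ^ 2).IsPrimitive := hD.prim.mul (by rw [sq]; exact hA1.mul hA1)
    have hdN : A * A1 ^ 2 ∣ Nm c1 e1 := by
      rw [IsPrimitive.Int.dvd_iff_map_cast_dvd_map_cast _ _ hprod]
      refine ⟨C (k ^ 2 / (n * k' ^ 2)), ?_⟩
      rw [Polynomial.map_mul, Polynomial.map_pow, hA1k]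
      unfold Nm
      simp only [Polynomial.map_add, Polynomial.map_sub, Polynomial.map_mul, Polynomial.map_pow, map_C, Int.coe_castRingHom]
      change mp c1 ^ 2 - mp c1 * C (e1 : ℚ) - C (e1 : ℚ) ^ 2 * mp F = mp A * _ * _
      rw [hc1q, he1q]
      have h1 : C (n : ℚ) * C k' ^ 2 * C (k ^ 2 / (n * k' ^ 2)) = C k ^ 2 := by
        rw [← C_pow, ← C_mul, ← C_mul, ← C_pow]
        congr 1
        field_simp
      apply mul_left_cancel₀ (C_ne_zero.2 hnq)
      linear_combination C k ^ 2 * heq - mp A * A' ^ 2 * h1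
    obtain ⟨U, hU⟩ := hdN
    have hUd : U.natDegree = 0 := by
      by_cases hU0 : U = 0
      · simp [hU0]
      have h1 := natDegree_Nm (e := e1) hc1d
      rw [hU, natDegree_mul hprod.ne_zero hU0, natDegree_mul hD.prim.ne_zero (pow_ne_zero 2 hA1.ne_zero), natDegree_pow, hD.deg, hA1d] at h1
      omega
    rw [eq_C_of_natDegree_eq_zero hUd] at hU
    refine ⟨A1, c1, e1, U.coeff 0, hA1d, hA1, ?_, ⟨hc1d, ?_⟩, by rw [hU]; ring, ?_⟩
    · intro h
      rw [h] at hg4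
      simp [hk, he] at hg4
    · rw [IsPrimitive.Int.dvd_iff_map_cast_dvd_map_cast _ _ hD.prim]
      simp only [Polynomial.map_sub, Polynomial.map_mul, map_C, Int.coe_castRingHom]
      change mp A ∣ C (es : ℚ) * mp c1 - C (e1 : ℚ) * mp cs
      rw [hc1q, he1q]
      obtain ⟨t, ht⟩ := hdvd
      exact ⟨C k * t, by linear_combination C k * ht⟩
    · rintro ⟨⟨s, hs⟩, ⟨t, ht⟩⟩
      have : C (2 : ℤ) ∣ g := ⟨s + C t * X ^ 4, by
        have h1 : g = c1 + C e1 * X ^ 4 := by rw [hc1]; ring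
        rw [h1, hs, ht, C_mul]; ring⟩
      have := hg 2 this
      rw [Int.isUnit_iff] at this
      norm_num at this
end G2

set_option linter.unusedSimpArgs false
namespace G2
open Polynomial NumberField

theorem prim_map_ne {A : ℤ[X]} (hA : A.IsPrimitive) : A.map (Int.castRingHom (ZMod 2)) ≠ 0 := by
  intro h
  have h1 : C ((2 : ℕ) : ℤ) ∣ A := C_dvd_of_map h
  have h2 := hA _ h1
  rw [Int.isUnit_iff] at h2
  omega

theorem key2 {a c w y : (ZMod 2)[X]} (ha : a ≠ 0) (hw : w.natDegree ≤ 1) (hy : y.natDegree ≤ 3)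
    (hr : ∀ b : (ZMod 2)[X], b.natDegree ≤ 1 → c ≠ a * b) (h : a ^ 2 * y = w * c ^ 2) : w = 0 := by
  by_contra hw0
  have : Fact (Nat.Prime 2) := ⟨Nat.prime_two⟩
  obtain ⟨b, hb⟩ := sq_dvd ha hw0 hw h
  refine hr b ?_ hb
  have h1 : y = w * b ^ 2 := by
    apply mul_left_cancel₀ (pow_ne_zero 2 ha)
    rw [h, hb]; ring
  by_cases hb0 : b = 0
  · simp [hb0]
  rw [h1, natDegree_mul hw0 (pow_ne_zero 2 hb0), natDegree_pow] at hy
  omega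

theorem keyK {A c : ℤ[X]} (hA : A.IsPrimitive)
    (hr : ∀ b : (ZMod 2)[X], b.natDegree ≤ 1 → c.map (Int.castRingHom (ZMod 2)) ≠ A.map (Int.castRingHom (ZMod 2)) * b) (m : ℕ) :
    ∀ w y R : ℤ[X], w.natDegree ≤ 1 → y.natDegree ≤ 3 → w * c ^ 2 - A ^ 2 * y = C (2 ^ m : ℤ) * R → C (2 ^ m : ℤ) ∣ w := by
  induction m with
  | zero => intro w y R _ _ _; simp
  | succ m ih =>
    intro w y R hw hy h
    have hC : (C (2 ^ (m + 1) : ℤ) : ℤ[X]) = C 2 * C (2 ^ m : ℤ) := by rw [← C_mul]; ring_nf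
    have hw2 : C ((2 : ℕ) : ℤ) ∣ w := by
      apply C_dvd_of_map
      refine key2 (y := y.map (Int.castRingHom (ZMod 2))) (prim_map_ne hA) (natDegree_map_le.trans hw) (natDegree_map_le.trans hy) hr ?_
      have h2 := congrArg (Polynomial.map (Int.castRingHom (ZMod 2))) h
      have h3 : (C (2 : ℤ) : ℤ[X]).map (Int.castRingHom (ZMod 2)) = 0 := map_of_C_dvd (p := 2) (dvd_refl _)
      rw [hC, Polynomial.map_mul, Polynomial.map_mul, h3, zero_mul, zero_mul] at h2
      simp only [Polynomial.map_sub, Polynomial.map_mul, Polynomial.map_pow] at h2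
      linear_combination -h2
    obtain ⟨w', rfl⟩ := hw2
    have hy2 : C (2 : ℤ) ∣ y := by
      apply C_cancel hA
      apply C_cancel hA
      refine ⟨w' * c ^ 2 - C (2 ^ m : ℤ) * R, ?_⟩
      rw [hC] at h
      push_cast at h
      linear_combination -h
    obtain ⟨y', rfl⟩ := hy2
    have h2 : (C (2 : ℤ) : ℤ[X]) ≠ 0 := by simp
    rw [natDegree_C_mul (by norm_num)] at hw hy
    have := ih w' y' R hw hy (by
      apply mul_left_cancel₀ h2
      rw [hC] at h
      push_cast at h
      linear_combination h)
    rw [hC]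
    push_cast
    exact mul_dvd_mul_left _ this

/-- combined form -/
theorem keyT {A c w0 w1 : ℤ[X]} {e : ℤ} {n : ℕ} (hA : A.IsPrimitive) (hAd : A.natDegree = 2) (hn : 1 ≤ n) (he : 2 ^ n ∣ e)
    (hc : c.natDegree ≤ 3) (hw0 : w0.natDegree ≤ 4) (hw1 : w1.natDegree ≤ 1)
    (hr : ∀ b : (ZMod 2)[X], b.natDegree ≤ 1 → c.map (Int.castRingHom (ZMod 2)) ≠ A.map (Int.castRingHom (ZMod 2)) * b)
    (hT : A ^ 2 ∣ w1 * (c ^ 2 + C e ^ 2 * F) - w0 * C e * (2 * c - C e)) : C (2 ^ (n + 1) : ℤ) ∣ w1 := by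
  obtain ⟨y, hy⟩ := hT
  obtain ⟨k, rfl⟩ := he
  obtain ⟨m, rfl⟩ : ∃ m, n = m + 1 := ⟨n - 1, by omega⟩
  have hdF := natDegree_F
  have hyd : y.natDegree ≤ 3 := by
    refine deg_of_mul hAd rfl (deg_of_mul hAd (Q := A * y) rfl ?_)
    rw [← mul_assoc, ← pow_two, ← hy]
    refine (natDegree_sub_le _ _).trans (max_le (natDegree_mul_le.trans ?_) (natDegree_mul_le.trans ?_))
    · have : (c ^ 2 + C (2 ^ (m + 1) * k) ^ 2 * F).natDegree ≤ 6 := by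
        refine (natDegree_add_le _ _).trans (max_le (natDegree_pow_le.trans (by omega)) ?_)
        rw [← C_pow]
        exact (natDegree_C_mul_le _ _).trans hdF
      omega
    · have h1 : (w0 * C (2 ^ (m + 1) * k)).natDegree ≤ 4 := (natDegree_mul_C_le _ _).trans hw0
      have h2 : (2 * c - C (2 ^ (m + 1) * k)).natDegree ≤ 3 := by
        refine (natDegree_sub_le _ _).trans (max_le (natDegree_mul_le.trans ?_) ((natDegree_C _).trans_le (by omega)))
        simpa using hc
      omega
  refine keyK hA hr _ w1 y (-(C (2 ^ m * k ^ 2) * F * w1) + w0 * C k * (c - C (2 ^ m * k))) hw1 hyd ?_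
  rw [← hy]
  simp only [map_mul, map_pow, map_ofNat]
  ring

theorem evenC {c : ℤ[X]} {e : ℤ} {m : ℕ} (h : C (2 ^ m : ℤ) ∣ C e * c) (hc : ¬ C (2 : ℤ) ∣ c) : 2 ^ m ∣ e := by
  rw [← dvd_content_iff_C_dvd, content_C_mul] at h
  rw [← dvd_content_iff_C_dvd] at hc
  have hcop : IsCoprime (2 ^ m : ℤ) c.content := by
    apply IsCoprime.pow_left
    exact (Int.prime_two.coprime_iff_not_dvd).2 hc
  have := hcop.dvd_of_dvd_mul_right h
  exact (dvd_normalize_iff).1 this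

theorem C_dvd_C {a b : ℤ} (h : (C a : ℤ[X]) ∣ C b) : a ∣ b := by
  rw [C_dvd_iff_dvd_coeff] at h
  simpa using h 0

theorem dv_half {A A' cs c1 : ℤ[X]} {es e1 u : ℤ} (hA'd : A'.natDegree = 2) (hA' : A'.IsPrimitive) (he1 : e1 ≠ 0)
    (hm : Mem A cs es c1 e1) (hN : Nm c1 e1 = C u * (A * A' ^ 2)) : Dv A' (C e1 - c1) e1 := by
  refine ⟨hA'd, hA', he1, ?_, ?_⟩
  · exact (natDegree_sub_le _ _).trans (max_le (by simp) hm.1)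
  · refine ⟨C u * (A * A'), ?_⟩
    unfold Nm at *
    linear_combination hN

theorem prim_sq {A P : ℤ[X]} {k : ℤ} (hA : A.IsPrimitive) (hk : k ≠ 0) (h : A ^ 2 ∣ C k * P) : A ^ 2 ∣ P := by
  refine cancelC ?_ hk h
  rw [pow_two]; exact hA.mul hA

theorem claim1 {A A' cs c1 c2 c : ℤ[X]} {es e1 u e2 e : ℤ} {n : ℕ} (hD : Dv A cs es) (hA'd : A'.natDegree = 2) (hA' : A'.IsPrimitive)
    (he1 : e1 ≠ 0)
    (hm : Mem A cs es c1 e1) (hN : Nm c1 e1 = C u * (A * A' ^ 2)) (h2 : ¬ (C (2 : ℤ) ∣ c1 ∧ 2 ∣ e1))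
    (hR : Rd A' c2 e2) (hM : Mem A' (C e1 - c1) e1 c2 e2) (hH : Mem A cs es c e)
    (hn : 1 ≤ n) (hdv : 2 ^ n ∣ e2) : 2 ^ (n + 1) ∣ e := by
  obtain ⟨p, hp⟩ := hM.2
  have hr := hR.red 2 Nat.prime_two ((dvd_pow_self _ (by omega)).trans hdv)
  have hw1 : A ∣ C e * c1 - c * C e1 := by
    obtain ⟨s, hs⟩ := hm.2
    obtain ⟨t, ht⟩ := hH.2
    exact cancelC hD.prim hD.ne ⟨C e * s - C e1 * t, by linear_combination C e * hs - C e1 * ht⟩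
  obtain ⟨w1, hw1⟩ := hw1
  have hw0 : A ∣ c * (c1 - C e1) - C e * C e1 * F := by
    apply cancelC hD.prim he1
    -- e1*c = e c1 - A w1
    refine ⟨-w1 * (c1 - C e1) + C e * C u * A' ^ 2, ?_⟩
    unfold Nm at hN
    linear_combination C e * hN - (c1 - C e1) * hw1
  obtain ⟨w0, hw0⟩ := hw0
  have hAne : A ≠ 0 := by intro h; have := hD.deg; simp [h] at this
  have hkey : w1 * (C e1 - c1) - w0 * C e1 = - C e * C u * A' ^ 2 := by
    apply mul_left_cancel₀ hAne
    unfold Nm at hN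
    linear_combination -(C e1 - c1) * hw1 + C e1 * hw0 - C e * hN
  have hdeg1 : w1.natDegree ≤ 1 := by
    refine deg_of_mul hD.deg hw1 ?_
    exact (natDegree_sub_le _ _).trans (max_le ((natDegree_C_mul_le _ _).trans hm.1) ((natDegree_mul_C_le _ _).trans hH.1))
  have hdc : (c1 - C e1).natDegree ≤ 3 := (natDegree_sub_le _ _).trans (max_le hm.1 (by simp))
  have hdeg0 : w0.natDegree ≤ 4 := by
    refine deg_of_mul hD.deg hw0 ?_
    refine (natDegree_sub_le _ _).trans (max_le (natDegree_mul_le.trans ?_) ?_)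
    · have := hH.1
      omega
    · rw [← C_mul]
      exact (natDegree_C_mul_le _ _).trans natDegree_F
  have gen : ∀ v0 v1 : ℤ[X], C e1 ^ 2 * (v1 * (c2 ^ 2 + C e2 ^ 2 * F) - v0 * C e2 * (2 * c2 - C e2)) =
      v1 * A' ^ 2 * (p ^ 2 - C e2 ^ 2 * C u * A) + (2 * A' * p * C e2 + C e2 ^ 2 * (C e1 - 2 * c1)) * (v1 * (C e1 - c1) - v0 * C e1) := by
    intro v0 v1
    unfold Nm at hN
    have hq : C e1 * c2 = A' * p + C e2 * (C e1 - c1) := by linear_combination hp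
    linear_combination (v1 * (C e1 * c2 + A' * p + C e2 * (C e1 - c1)) - v0 * C e2 * C e1 * 2) * hq - v1 * C e2 ^ 2 * hN
  have k1 : C (2 ^ (n + 1) : ℤ) ∣ w1 := by
    refine keyT hA' hA'd hn hdv hR.degc hdeg0 hdeg1 hr ?_
    refine prim_sq hA' (pow_ne_zero 2 he1) ⟨w1 * (p ^ 2 - C e2 ^ 2 * C u * A) 
      + (2 * A' * p * C e2 + C e2 ^ 2 * (C e1 - 2 * c1)) * (-C e * C u), ?_⟩
    rw [C_pow, gen w0 w1, hkey]
    ring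
  have k2 : 2 ^ (n + 1) ∣ e1 := by
    apply C_dvd_C
    rw [← dvd_neg]
    refine keyT (w0 := c1 - C e1) hA' hA'd hn hdv hR.degc (by omega) (by simp) hr ?_
    refine prim_sq hA' (pow_ne_zero 2 he1) ⟨-C e1 * (p ^ 2 - C e2 ^ 2 * C u * A), ?_⟩
    rw [C_pow, gen]
    ring
  have k3 : ¬ C (2 : ℤ) ∣ c1 := fun h => h2 ⟨h, (dvd_pow_self _ (by omega)).trans k2⟩
  refine evenC (c := c1) ?_ k3
  have : C e * c1 = A * w1 + c * C e1 := by linear_combination hw1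
  rw [this]
  exact dvd_add (k1.mul_left _) ((C_dvd_iff_dvd_coeff _ _ |>.2 fun i => by
    rw [coeff_mul_C]; exact k2.mul_left _))

end G2

set_option linter.unusedSimpArgs false
namespace G2
open Polynomial NumberField

theorem parity_cases (a0 a1 a2 r0 r1 r2 p0 p1 : ZMod 2) (h4 : a2 * r2 = 0) (h3 : a2 * r1 + a1 * r2 = 0)
    (h2 : a2 * r0 + a1 * r1 + a0 * r2 = 0) (h1 : a1 * r0 + a0 * r1 = p1) (h0 : a0 * r0 = p0) (hp : ¬ (p0 = 0 ∧ p1 = 0)) :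
    a2 = 0 ∧ (a1 = 0 ∨ (a1 = 1 ∧ a0 = 1) ∨ (a1 = 1 ∧ a0 = 0 ∧ p0 = 0 ∧ p1 = 1 ∧ r0 = 1)) := by
  revert a0 a1 a2 r0 r1 r2 p0 p1
  decide

theorem form1 {R : Type*} [Semiring R] {A : R[X]} (h : A.natDegree ≤ 1) : 
    A = C (A.coeff 0) + C (A.coeff 1) * X := by
  conv_lhs => rw [A.as_sum_range' 2 (by omega)]
  simp [Finset.sum_range_succ, ← C_mul_X_pow_eq_monomial]

theorem z0 {a : ℤ} : ((a : ℤ) : ZMod 2) = 0 ↔ 2 ∣ a := ZMod.intCast_zmod_eq_zero_iff_dvd a 2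
theorem z1 {a : ℤ} : ((a : ℤ) : ZMod 2) = 1 ↔ ¬ 2 ∣ a := by
  rw [← z0]
  generalize ((a : ℤ) : ZMod 2) = b
  revert b
  decide

/-- the reduction modulo two is a unit -/
theorem lev_unit {A c : ℤ[X]} {e : ℤ} (hA : A.natDegree = 2) (hc : c.natDegree ≤ 3) (h : A ∣ Nm c e) (h1 : 2 ∣ A.coeff 1)
    (h2 : 2 ∣ A.coeff 2) : 2 ∣ e := by
  obtain ⟨Q, hQ⟩ := h
  have hQd : Q.natDegree ≤ 4 := deg_of_mul hA hQ (natDegree_Nm hc)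
  rw [form3 hc, form2 hA.le, form4 hQd] at hQ
  obtain ⟨-, -, -, -, -, n5, n6⟩ := nm_coeff hQ
  obtain ⟨k1, h1⟩ := h1
  obtain ⟨k2, h2⟩ := h2
  rw [h1, h2] at n5
  rw [h2] at n6
  have : 2 ∣ e ^ 2 := ⟨c.coeff 2 * c.coeff 3 - k1 * Q.coeff 4 - k2 * Q.coeff 3, by linear_combination -n5⟩
  exact Int.prime_two.dvd_of_dvd_pow this

theorem lev_X1 {A c : ℤ[X]} {e : ℤ} (h : A ∣ Nm c e) (hA : 2 ∣ A.eval 1) : 2 ∣ e := by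
  obtain ⟨Q, hQ⟩ := h
  have := congrArg (eval 1) hQ
  obtain ⟨k, hk⟩ := hA
  unfold Nm F at this
  simp [hk] at this
  generalize eval 1 c = d at this
  generalize eval 1 Q = q at this
  by_contra he
  obtain ⟨f, hf⟩ : ∃ f, e = 2 * f + 1 := ⟨e / 2, by omega⟩
  subst hf
  rcases Int.even_or_odd' d with ⟨g, rfl | rfl⟩
  · ring_nf at this; omega
  · ring_nf at this; omega

theorem claim2 {A A' cs c1 c2 : ℤ[X]} {es e1 u e2 : ℤ} (hD : Dv A cs es) (hA'd : A'.natDegree = 2) (hA' : A'.IsPrimitive)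
    (he1 : e1 ≠ 0)
    (hm : Mem A cs es c1 e1) (hN : Nm c1 e1 = C u * (A * A' ^ 2)) (h2 : ¬ (C (2 : ℤ) ∣ c1 ∧ 2 ∣ e1))
    (hL : ∀ c e, Mem A cs es c e → 2 ∣ e) (hM : Mem A' (C e1 - c1) e1 c2 e2) : 2 ∣ e2 := by
  by_contra he2
  have he1' := hL _ _ hm
  have hD' := dv_half hA'd hA' he1 hm hN
  have hN' := hM.nm hD'
  have hN'' := hN'
  obtain ⟨Q, hQ⟩ := hN'
  have hQd : Q.natDegree ≤ 4 := deg_of_mul hA'd hQ (natDegree_Nm hM.1)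
  obtain ⟨p, hp⟩ := hM.2
  have hA'0 : A' ≠ 0 := by intro h; simp [h] at hA'd
  have hAne : A ≠ 0 := by intro h; have := hD.deg; simp [h] at this
  have hpd : p.natDegree ≤ 1 := by
    refine deg_of_mul hA'd hp ?_
    refine (natDegree_sub_le _ _).trans (max_le ((natDegree_C_mul_le _ _).trans hM.1) ((natDegree_C_mul_le _ _).trans hD'.degc))
  have hp2 : ¬ C (2 : ℤ) ∣ p := by
    rintro ⟨p', rfl⟩
    obtain ⟨k, rfl⟩ := he1'
    refine h2 ⟨?_, dvd_mul_right _ _⟩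
    have : C (2 ^ 1 : ℤ) ∣ c1 * C e2 := ⟨A' * p' - C k * c2 + C e2 * C k, by
      simp only [map_mul, pow_one, map_ofNat] at hp ⊢
      linear_combination hp⟩
    by_contra hc
    rw [mul_comm] at this
    exact he2 (evenC this hc)
  have hr : C e1 ∣ p ^ 2 - C e2 ^ 2 * C u * A := by
    apply C_cancel hA'
    apply C_cancel hA'
    refine ⟨C e1 * (c2 ^ 2 + C e2 ^ 2 * F) + (c1 - C e1) * C e2 * (2 * c2 - C e2), ?_⟩
    unfold Nm at hN
    linear_combination (-A' * p - (C e1 * c2 - C e2 * (C e1 - c1))) * hp + C e2 ^ 2 * hN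
  obtain ⟨r, hr⟩ := hr
  have hrd : r.natDegree ≤ 2 := by
    rw [← natDegree_C_mul (p := r) he1, ← hr]
    refine (natDegree_sub_le _ _).trans (max_le (natDegree_pow_le.trans (by omega)) ?_)
    rw [← C_pow, ← C_mul]
    exact (natDegree_C_mul_le _ _).trans hD.deg.le
  have hC1 : (C e1 : ℤ[X]) ≠ 0 := by simpa using he1
  have hmain : A' * r = p * (2 * c2 - C e2) - C e1 * Q := by
    apply mul_left_cancel₀ hC1
    apply mul_left_cancel₀ hA'0
    unfold Nm at hN hQ
    linear_combination -A' ^ 2 * hr + (-A' * p - (C e1 * c2 - C e2 * (C e1 - c1))) * hp + C e2 ^ 2 * hN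
      + C e1 * (2 * c2 - C e2) * hp - C e1 ^ 2 * hQ
  have f1 := form2 hA'd.le
  have f2 := form2 hrd
  have f3 := form1 hpd
  have f4 := form3 hM.1
  have f5 := form4 hQd
  set a0 := A'.coeff 0
  set a1 := A'.coeff 1
  set a2 := A'.coeff 2
  set r0 := r.coeff 0
  set r1 := r.coeff 1
  set r2 := r.coeff 2
  set p0 := p.coeff 0
  set p1 := p.coeff 1
  set d0 := c2.coeff 0
  set d1 := c2.coeff 1
  set d2 := c2.coeff 2
  set d3 := c2.coeff 3
  set q0 := Q.coeff 0
  set q1 := Q.coeff 1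
  set q2 := Q.coeff 2
  set q3 := Q.coeff 3
  set q4 := Q.coeff 4
  have heqs := lin7 (k0 := a0 * r0 - p0 * (2 * d0 - e2) + e1 * q0)
    (k1 := a0 * r1 + a1 * r0 - p0 * 2 * d1 - p1 * (2 * d0 - e2) + e1 * q1)
    (k2 := a0 * r2 + a1 * r1 + a2 * r0 - p0 * 2 * d2 - p1 * 2 * d1 + e1 * q2)
    (k3 := a1 * r2 + a2 * r1 - p0 * 2 * d3 - p1 * 2 * d2 + e1 * q3)
    (k4 := a2 * r2 - p1 * 2 * d3 + e1 * q4) (k5 := 0) (k6 := 0) (by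
      have hm2 := hmain
      rw [f1, f2, f3, f4, f5] at hm2
      simp only [map_add, map_sub, map_mul, map_pow, map_ofNat, map_zero]
      linear_combination hm2)
  obtain ⟨k0, k1, k2, k3, k4, -, -⟩ := heqs
  have hz1 : ((e1 : ℤ) : ZMod 2) = 0 := z0.2 he1'
  have hz2 : ((e2 : ℤ) : ZMod 2) = 1 := z1.2 he2
  have two0 : (2 : ZMod 2) = 0 := by decide
  have K := fun z : ℤ => congrArg (fun z : ℤ => (z : ZMod 2)) (a₁ := z) (a₂ := 0)
  have m0 := K _ k0
  have m1 := K _ k1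
  have m2 := K _ k2
  have m3 := K _ k3
  have m4 := K _ k4
  push_cast at m0 m1 m2 m3 m4
  simp only [hz1, hz2, two0, mul_zero, zero_mul, sub_zero, zero_sub, add_zero, mul_neg, mul_one, sub_neg_eq_add] at m0 m1 m2 m3 m4
  have neg2 : ∀ x y : ZMod 2, x + y = 0 → x = y := by decide
  have pc := parity_cases a0 a1 a2 r0 r1 r2 p0 p1 m4 (by linear_combination m3) (by linear_combination m2)
    (neg2 _ _ (by linear_combination m1)) (neg2 _ _ m0) (by
      rw [z0, z0]
      rintro ⟨⟨x, hx⟩, ⟨y, hy⟩⟩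
      apply hp2
      refine ⟨C x + C y * X, ?_⟩
      rw [f3, hx, hy]
      simp only [map_mul]
      ring)
  obtain ⟨ha2, h1 | ⟨h1, h0⟩ | ⟨ha1, ha0, hp0, hp1, hr0⟩⟩ := pc
  · exact he2 (lev_unit hA'd hM.1 hN'' (z0.1 h1) (z0.1 ha2))
  · refine he2 (lev_X1 hN'' ?_)
    rw [f1]
    simp only [eval_add, eval_mul, eval_C, eval_X, eval_pow, one_pow, mul_one]
    rw [← z0]
    push_cast
    rw [ha2, h1, h0]
    decide
  rw [z0] at hp0 
  rw [z1] at hp1 hr0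
  obtain ⟨m, k, hk, hek⟩ : ∃ (m : ℕ) (k : ℤ), ¬ 2 ∣ k ∧ e1 = 2 ^ m * k := by
    obtain ⟨m, k, hk, h⟩ := WfDvdMonoid.max_power_factor he1 Int.prime_two.irreducible
    exact ⟨m, k, hk, h⟩
  have hρ : 2 ^ m ∣ a2 * p0 ^ 2 - a1 * p0 * p1 + a0 * p1 ^ 2 := by
    have hodd : ¬ 2 ∣ r2 * p0 ^ 2 - r1 * p0 * p1 + r0 * p1 ^ 2 := by
      obtain ⟨x, hx⟩ := hp0
      intro hd
      have : 2 ∣ r0 * p1 ^ 2 := by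
        have h3 : r0 * p1 ^ 2 = (r2 * p0 ^ 2 - r1 * p0 * p1 + r0 * p1 ^ 2) - 2 * (x * (r2 * p0 - r1 * p1)) := by
          rw [hx]; ring
        rw [h3]
        exact dvd_sub hd (dvd_mul_right _ _)
      rcases Int.prime_two.dvd_or_dvd this with h | h
      · exact hr0 h
      · exact hp1 (Int.prime_two.dvd_of_dvd_pow h)
    have hprod : 2 ^ m ∣ (a2 * p0 ^ 2 - a1 * p0 * p1 + a0 * p1 ^ 2) * (r2 * p0 ^ 2 - r1 * p0 * p1 + r0 * p1 ^ 2) := by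
      refine ⟨-k * (q4 * p0 ^ 4 - q3 * p0 ^ 3 * p1 + q2 * p0 ^ 2 * p1 ^ 2 - q1 * p0 * p1 ^ 3 + q0 * p1 ^ 4), ?_⟩
      linear_combination p0 ^ 4 * k4 - p0 ^ 3 * p1 * k3 + p0 ^ 2 * p1 ^ 2 * k2 - p0 * p1 ^ 3 * k1 + p1 ^ 4 * k0
        - (q4 * p0 ^ 4 - q3 * p0 ^ 3 * p1 + q2 * p0 ^ 2 * p1 ^ 2 - q1 * p0 * p1 ^ 3 + q0 * p1 ^ 4) * hek
    exact (IsCoprime.pow_left ((Int.prime_two.coprime_iff_not_dvd).2 hodd)).dvd_of_dvd_mul_right hprod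
  obtain ⟨ρ, hρ⟩ := hρ
  have hs : C p1 ^ 2 * A' - C (2 ^ m * ρ) = p * (C (a2 * p1) * X + C (a1 * p1 - a2 * p0)) := by
    rw [← hρ, f1, f3]
    simp only [map_add, map_sub, map_mul, map_pow]
    ring
  set s : ℤ[X] := C (a2 * p1) * X + C (a1 * p1 - a2 * p0)
  have hsd : s.natDegree ≤ 1 := natDegree_linear_le
  have hek' : (C e1 : ℤ[X]) = C (2 ^ m) * C k := by rw [← C_mul, ← hek]
  have hρ' : (C (2 ^ m * ρ) : ℤ[X]) = C (2 ^ m) * C ρ := C_mul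
  have h2m : (2 ^ m : ℤ) ≠ 0 := by positivity
  have hcc : C (2 ^ m) * (C ρ * p + s * C k * r - C p1 ^ 2 * C k * (c2 - C e2)) = C p1 ^ 2 * C e2 * c1 - s * C e2 ^ 2 * C u * A := by
    linear_combination - p * hs - p * hρ' - (s * r - C p1 ^ 2 * (c2 - C e2)) * hek' - C p1 ^ 2 * hp - s * hr
  have hodd : ¬ 2 ∣ p1 ^ 2 * e2 * k := by
    intro h
    rcases Int.prime_two.dvd_or_dvd h with h | h
    · rcases Int.prime_two.dvd_or_dvd h with h | h
      · exact hp1 (Int.prime_two.dvd_of_dvd_pow h)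
      · exact he2 h
    · exact hk h
  refine hodd (hL (C ρ * p + s * C k * r - C p1 ^ 2 * C k * (c2 - C e2)) _ ⟨?_, ?_⟩)
  · refine (natDegree_sub_le _ _).trans (max_le ((natDegree_add_le _ _).trans (max_le ?_ ?_)) ?_)
    · exact (natDegree_C_mul_le _ _).trans (by omega)
    · refine natDegree_mul_le.trans ?_
      have := (natDegree_mul_C_le s k)
      omega
    · rw [← C_pow, ← C_mul]
      exact (natDegree_C_mul_le _ _).trans ((natDegree_sub_le _ _).trans (max_le hM.1 (by simp)))
  · apply cancelC hD.prim h2m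
    obtain ⟨t, ht⟩ := hm.2
    refine ⟨C p1 ^ 2 * C e2 * t - C es * s * C e2 ^ 2 * C u, ?_⟩
    have hx : (C (p1 ^ 2 * e2 * k) : ℤ[X]) = C p1 ^ 2 * C e2 * C k := by simp only [map_mul, map_pow]
    rw [hx]
    linear_combination C es * hcc + C p1 ^ 2 * C e2 * ht + C p1 ^ 2 * C e2 * cs * hek'

end G2

set_option linter.unusedSimpArgs false
namespace G2
open Polynomial NumberField

theorem lin_dvd {M P : ℤ[X]} {p q : ℤ} (hM : M = C p * X - C q) (hp : p ≠ 0) (hprim : M.IsPrimitive) :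
    M ∣ P ↔ aeval (q / p : ℚ) P = 0 := by
  have hpq : (p : ℚ) ≠ 0 := by exact_mod_cast hp
  rw [IsPrimitive.Int.dvd_iff_map_cast_dvd_map_cast _ _ hprim]
  have h1 : M.map (Int.castRingHom ℚ) = C (p : ℚ) * (X - C (q / p : ℚ)) := by
    rw [hM]
    simp only [Polynomial.map_sub, Polynomial.map_mul, map_C, map_X, Int.coe_castRingHom, mul_sub, ← C_mul]
    congr 2
    field_simp
  have hu : IsUnit (C (p : ℚ) : ℚ[X]) := by rw [isUnit_C, isUnit_iff_ne_zero]; exact hpq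
  rw [h1, hu.mul_left_dvd, dvd_iff_isRoot, IsRoot.def, eval_map, aeval_def]
  rfl

theorem lin_prim {p q : ℤ} (h : IsCoprime p q) : (C p * X - C q : ℤ[X]).IsPrimitive := by
  intro r hr
  rw [C_dvd_iff_dvd_coeff] at hr
  have h0 := hr 0
  have h1 := hr 1
  simp only [coeff_sub, coeff_C_mul, coeff_X_zero, coeff_C_zero, mul_zero, zero_sub, dvd_neg] at h0
  simp only [coeff_sub, coeff_C_mul, coeff_X_one, coeff_C_succ, mul_one, sub_zero] at h1
  exact h.isUnit_of_dvd' h1 h0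

theorem two_form : (2 * X - 1 : ℤ[X]) = C 2 * X - C 1 := by simp

theorem two_prim : (2 * X - 1 : ℤ[X]).IsPrimitive := by
  rw [two_form]; exact lin_prim (by simp)

theorem half_dvd {P : ℤ[X]} : (2 * X - 1) ∣ P ↔ aeval (1 / 2 : ℚ) P = 0 := by
  rw [lin_dvd two_form (by norm_num) two_prim]
  norm_num

theorem two_dvd {M P : ℤ[X]} (h0 : aeval (1 / 2 : ℚ) M ≠ 0) (h1 : M ∣ P) (h2 : aeval (1 / 2 : ℚ) P = 0) : (2 * X - 1) * M ∣ P := by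
  obtain ⟨g, rfl⟩ := h1
  rw [mul_comm]
  apply mul_dvd_mul_left
  rw [map_mul] at h2
  exact half_dvd.2 ((mul_eq_zero.1 h2).resolve_left h0)

theorem F_half : aeval (1 / 2 : ℚ) F = -1 / 4 := by
  unfold F
  simp only [map_sub, map_add, map_mul, map_neg, map_pow, map_ofNat, aeval_X]
  norm_num

theorem claim1d {A M cs c' : ℤ[X]} {es s e' : ℤ} {n : ℕ} (hD : Dv A cs es) (hM : M.IsPrimitive)
    (hA : A = C s * M ^ 2) (hM0 : aeval (1 / 2 : ℚ) M ≠ 0) (hR : Rd ((2 * X - 1) * M) c' e')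
    (h1 : aeval (1 / 2 : ℚ) (2 * c' - C e') = 0) (h2 : M ∣ C es * c' - C e' * cs)
    (hn : 1 ≤ n) (hdv : 2 ^ n ∣ e') : 2 ^ (n + 1) ∣ es := by
  have hr := hR.red 2 Nat.prime_two ((dvd_pow_self _ (by omega)).trans hdv)
  have d2 : (2 * X - 1 : ℤ[X]).natDegree ≤ 1 := by compute_degree
  have key : C (2 ^ (n + 1) : ℤ) ∣ (2 * X - 1) * C es := by
    refine keyT (w0 := (2 * X - 1) * cs) hR.prim hR.deg hn hdv hR.degc ?_ ?_ hr ?_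
    · exact natDegree_mul_le.trans (by have := hD.degc; omega)
    · exact (natDegree_mul_C_le _ _).trans d2
    · have hG : (2 * X - 1) * M ^ 2 ∣ C es * (c' ^ 2 + C e' ^ 2 * F) - cs * C e' * (2 * c' - C e') := by
        refine two_dvd (by rw [map_pow]; exact pow_ne_zero 2 hM0) ?_ ?_
        · refine prim_sq hM hD.ne ?_
          obtain ⟨t, ht⟩ := h2
          obtain ⟨N, hN⟩ := hD.dvd
          refine ⟨t ^ 2 - C e' ^ 2 * C s * N, ?_⟩
          rw [hA] at hN
          unfold Nm at hN
          linear_combination (C es * c' - C e' * cs + M * t) * ht - C e' ^ 2 * hN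
        · have h3 : aeval (1 / 2 : ℚ) c' = e' / 2 := by
            simp only [map_sub, map_mul, map_ofNat, aeval_C, algebraMap_int_eq, eq_intCast, map_intCast] at h1
            linear_combination h1 / 2
          simp only [map_sub, map_mul, map_add, map_pow, F_half, h3, map_ofNat, aeval_C]
          simp
          ring
      obtain ⟨g, hg⟩ := hG
      refine ⟨g, ?_⟩
      linear_combination (2 * X - 1) * hg
  rw [mul_comm] at key
  refine evenC key ?_
  intro h
  have := two_prim _ h
  rw [Int.isUnit_iff] at this
  omega

theorem mod4_contra {n g0 g1 g2 g3 g4 p q t0 t1 t2 t3 t4 : ℤ} (hn : n = 1 ∨ n = -1 ∨ n = 5 ∨ n = -5) (hp : ¬ 2 ∣ p) (hq : 2 ∣ q)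
    (h0 : p + 2 * q + 4 * t0 = n * (g0 ^ 2 + 4 * g1 * g4 + 4 * g2 * g3))
    (h1 : - 4 * p + 4 * t1 = n * (2 * g0 * g1 + 4 * g2 * g4 + 2 * g3 ^ 2))
    (h2 : q + 4 * t2 = n * (2 * g0 * g2 + g1 ^ 2 + 4 * g3 * g4))
    (h3 : - 2 * q + 4 * t3 = n * (2 * g0 * g3 + 2 * g1 * g2 + 2 * g4 ^ 2))
    (h4 : 2 * p + 4 * t4 = n * (2 * g0 * g4 + 2 * g1 * g3 + g2 ^ 2)) : False := by
  have k0 : ¬ 2 ∣ g0 ^ 2 + 4 * g1 * g4 + 4 * g2 * g3 := by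
    generalize g0 ^ 2 + 4 * g1 * g4 + 4 * g2 * g3 = c at h0
    rcases hn with rfl | rfl | rfl | rfl <;> omega
  have k1 : 4 ∣ 2 * g0 * g1 + 4 * g2 * g4 + 2 * g3 ^ 2 := by
    generalize 2 * g0 * g1 + 4 * g2 * g4 + 2 * g3 ^ 2 = c at h1
    rcases hn with rfl | rfl | rfl | rfl <;> omega
  have k2 : 2 ∣ 2 * g0 * g2 + g1 ^ 2 + 4 * g3 * g4 := by
    generalize 2 * g0 * g2 + g1 ^ 2 + 4 * g3 * g4 = c at h2
    rcases hn with rfl | rfl | rfl | rfl <;> omega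
  have k3 : 4 ∣ 2 * g0 * g3 + 2 * g1 * g2 + 2 * g4 ^ 2 := by
    generalize 2 * g0 * g3 + 2 * g1 * g2 + 2 * g4 ^ 2 = c at h3
    rcases hn with rfl | rfl | rfl | rfl <;> omega
  have k4 : (2 * g0 * g4 + 2 * g1 * g3 + g2 ^ 2) % 4 = 2 := by
    generalize 2 * g0 * g4 + 2 * g1 * g3 + g2 ^ 2 = c at h4
    rcases hn with rfl | rfl | rfl | rfl <;> omega
  clear h0 h1 h2 h3 h4 hn
  have e1 : 2 ∣ g1 := by
    rcases Int.even_or_odd' g1 with ⟨x, rfl | rfl⟩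
    · omega
    · ring_nf at k2; omega
  have e2 : 2 ∣ g2 := by
    rcases Int.even_or_odd' g2 with ⟨x, rfl | rfl⟩
    · omega
    · ring_nf at k4; omega
  obtain ⟨x1, rfl⟩ := e1
  obtain ⟨x2, rfl⟩ := e2
  have e3 : 2 ∣ g3 := by
    rcases Int.even_or_odd' g3 with ⟨x, rfl | rfl⟩
    · omega
    · ring_nf at k1; omega
  obtain ⟨x3, rfl⟩ := e3
  have e4 : ¬ 2 ∣ g4 := by
    rintro ⟨x, rfl⟩
    ring_nf at k4; omega
  obtain ⟨x4, rfl⟩ : ∃ x, g4 = 2 * x + 1 := ⟨g4 / 2, by omega⟩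
  ring_nf at k3
  omega

theorem not_mod5 {p q : ℤ} (hp : ¬ 2 ∣ p) (hq : ¬ 2 ∣ q) {w : ℚ}
    (h : w ^ 2 = -8 * (q / p : ℚ) ^ 6 + 4 * (q / p) ^ 5 - 40 * (q / p) ^ 3 + 24 * (q / p) - 7) : False := by
  have hp0 : (p : ℚ) ≠ 0 := by rintro h; apply hp; simp [Int.cast_eq_zero.1 h]
  obtain ⟨N, hN⟩ : ∃ N : ℤ, N = -8 * q ^ 6 + 4 * q ^ 5 * p - 40 * q ^ 3 * p ^ 3 + 24 * q * p ^ 5 - 7 * p ^ 6 := ⟨_, rfl⟩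
  have hs : IsSquare ((N : ℤ) : ℚ) := by
    refine ⟨w * p ^ 3, ?_⟩
    have : w * p ^ 3 * (w * p ^ 3) = w ^ 2 * p ^ 6 := by ring
    rw [this, h, hN]
    push_cast
    field_simp
  rw [Rat.isSquare_intCast_iff] at hs
  obtain ⟨m, hm⟩ := hs
  have h8 : ((N : ℤ) : ZMod 8) = 5 := by
    have odd8 : ∀ x : ℤ, ¬ 2 ∣ x → ((x : ZMod 8) = 1 ∨ (x : ZMod 8) = 3 ∨ (x : ZMod 8) = 5 ∨ (x : ZMod 8) = 7) := by
      intro x hx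
      have : x % 8 = 1 ∨ x % 8 = 3 ∨ x % 8 = 5 ∨ x % 8 = 7 := by omega
      rw [← ZMod.intCast_mod x 8]
      rcases this with h | h | h | h <;> simp [h]
    rw [hN]
    push_cast
    rcases odd8 p hp with h | h | h | h <;> rcases odd8 q hq with h' | h' | h' | h' <;> rw [h, h'] <;> decide
  rw [hm] at h8
  push_cast at h8
  generalize (m : ZMod 8) = z at h8
  revert z
  decide

end G2

set_option linter.unusedSimpArgs false
namespace G2
open Polynomial NumberField

theorem p5_pow8 : p5 ^ 8 = 1 + 4 * (56 + 30 * a + 30 * a ^ 2 + 35 * a ^ 3 + 15 * a ^ 4) := by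
  unfold p5
  have : ∀ x : 𝓞 L, x ^ 5 = 2 → (1 + x ^ 2) ^ 8 = 1 + 4 * (56 + 30 * x + 30 * x ^ 2 + 35 * x ^ 3 + 15 * x ^ 4) := by
    intro x h
    have h6 : x ^ 6 = 2 * x := by linear_combination x * h
    have h8 : x ^ 8 = 2 * x ^ 3 := by linear_combination x ^ 3 * h
    have h10 : x ^ 10 = 4 := by linear_combination (x ^ 5 + 2) * h
    have h12 : x ^ 12 = 4 * x ^ 2 := by linear_combination x ^ 2 * h10
    have h14 : x ^ 14 = 4 * x ^ 4 := by linear_combination x ^ 4 * h10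
    have h16 : x ^ 16 = 8 * x := by linear_combination x ^ 6 * h10 + 4 * h6
    linear_combination 56 * h6 + 70 * h8 + 56 * h10 + 28 * h12 + 8 * h14 + h16
  exact this a a5

theorem prod_form (p q : ℤ) : (2 * X - 1) * (C p * X - C q) = (C q + C (-(p + 2 * q)) * X + C (2 * p) * X ^ 2 : ℤ[X]) := by
  simp only [map_add, map_mul, map_neg, map_ofNat]; ring

theorem prod_coeff (p q : ℤ) : ((2 * X - 1) * (C p * X - C q) : ℤ[X]).coeff 0 = q ∧ 
    ((2 * X - 1) * (C p * X - C q) : ℤ[X]).coeff 1 = -(p + 2 * q) ∧ ((2 * X - 1) * (C p * X - C q) : ℤ[X]).coeff 2 = 2 * p := by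
  rw [prod_form]
  refine ⟨?_, ?_, ?_⟩ <;> 
  simp only [coeff_add, coeff_C_mul, coeff_X, coeff_X_pow, coeff_C] <;> norm_num

theorem even_odd_contra {p q : ℤ} (hp : ¬ 2 ∣ p) (hq : 2 ∣ q) {c : ℤ[X]} {e : ℤ} (hR : Rd ((2 * X - 1) * (C p * X - C q)) c e) : False := by
  have hev := evenOut_bet hR
  obtain ⟨h0, h1, h2⟩ := prod_coeff p q
  obtain ⟨z, hz⟩ : ∃ z : 𝓞 L, z = ((p + 2 * q : ℤ) : 𝓞 L) + ((-4 * p : ℤ) : 𝓞 L) * a + ((q : ℤ) : 𝓞 L) * a ^ 2 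
      + ((-2 * q : ℤ) : 𝓞 L) * a ^ 3 + ((2 * p : ℤ) : 𝓞 L) * a ^ 4 := ⟨_, rfl⟩
  have hbz : bet ((2 * X - 1) * (C p * X - C q)) = a ^ 2 * z := by
    rw [hz]; unfold bet; rw [h0, h1, h2]; push_cast
    linear_combination (2 * q - 2 * p * a) * a5
  rw [hbz] at hev
  obtain ⟨k, hk⟩ := hq
  obtain ⟨n, γ, hn, hγ⟩ := classN z ⟨p, q, 0, q - 2 * p * a - q * a ^ 3 + p * a ^ 4, by
      rw [hz]; push_cast; ring⟩ (by rw [hz, a_dvd_iff]; omega) 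
      (hev.of_mul (fun π _ hd => dvd_a_ten (hd.trans (pow_dvd_pow a (by norm_num)))))
  rw [p5_pow8] at hγ
  obtain ⟨g0, g1, g2, g3, g4, rfl⟩ := int_rep γ
  obtain ⟨t0, t1, t2, t3, t4, ht⟩ := int_rep (z * (56 + 30 * a + 30 * a ^ 2 + 35 * a ^ 3 + 15 * a ^ 4))
  have hl := lin_Z (p + 2 * q + 4 * t0 - n * (g0 ^ 2 + 4 * g1 * g4 + 4 * g2 * g3))
    (- 4 * p + 4 * t1 - n * (2 * g0 * g1 + 4 * g2 * g4 + 2 * g3 ^ 2))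
    (q + 4 * t2 - n * (2 * g0 * g2 + g1 ^ 2 + 4 * g3 * g4))
    (- 2 * q + 4 * t3 - n * (2 * g0 * g3 + 2 * g1 * g2 + 2 * g4 ^ 2))
    (2 * p + 4 * t4 - n * (2 * g0 * g4 + 2 * g1 * g3 + g2 ^ 2)) (by
      push_cast at hz ⊢
      linear_combination hγ - 4 * ht - hz + 
        n * (2 * g1 * g4 + 2 * g2 * g3 + (2 * g2 * g4 + g3 ^ 2) * a + 2 * g3 * g4 * a ^ 2 + g4 ^ 2 * a ^ 3) * a5)
  simp only [sub_eq_zero] at hl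
  obtain ⟨l0, l1, l2, l3, l4⟩ := hl
  exact mod4_contra hn hp ⟨k, hk⟩ l0 l1 l2 l3 l4

theorem aeval_Nm (x : ℚ) (c : ℤ[X]) (e : ℤ) : aeval x (Nm c e) = (aeval x c) ^ 2 - aeval x c * e - e ^ 2 * aeval x F := by
  unfold Nm
  simp only [map_sub, map_mul, map_pow, aeval_C, algebraMap_int_eq, eq_intCast, map_intCast]

theorem aeval_lin (x : ℚ) (p q : ℤ) : aeval x (C p * X - C q) = p * x - q := by
  simp only [map_sub, map_mul, aeval_C, aeval_X, algebraMap_int_eq, eq_intCast, map_intCast]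

theorem start {p q : ℤ} (hpq : IsCoprime p q) (hp : p ≠ 0) (h2 : 2 * q ≠ p) {v : ℚ} (hv : v ^ 2 - v = aeval (q / p : ℚ) F) :
    ∃ c e, Rd ((2 * X - 1) * (C p * X - C q)) c e ∧ (∀ c' e', Mem ((2 * X - 1) * (C p * X - C q)) c e c' e' → 2 ∣ e') ∧
      aeval (1 / 2 : ℚ) (2 * c - C e) = 0 ∧ aeval (q / p : ℚ) c = e * v := by
  have hpQ : (p : ℚ) ≠ 0 := by exact_mod_cast hp
  have h2Q : (2 * q - p : ℚ) ≠ 0 := by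
    intro h; apply h2
    have : (2 * q : ℚ) = p := by linear_combination h
    exact_mod_cast this
  have hM := lin_prim hpq
  set M : ℤ[X] := C p * X - C q with hMdef
  have hMh : aeval (1 / 2 : ℚ) M ≠ 0 := by
    rw [hMdef, aeval_lin]
    intro h
    apply h2Q
    linear_combination -2 * h
  have hsd : ((v.den : ℤ) : ℚ) ≠ 0 := by exact_mod_cast v.den_nz
  have hvd : v * v.den = v.num := Rat.mul_den_eq_num v
  obtain ⟨s, hs⟩ : ∃ s : ℤ, s = v.den := ⟨_, rfl⟩
  obtain ⟨r, hr⟩ : ∃ r : ℤ, r = v.num := ⟨_, rfl⟩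
  rw [← hs] at hsd
  have hvr : v * s = r := by rw [hs, hr]; exact_mod_cast hvd
  have hev : ∀ x : ℚ, aeval x (C (s * (2 * q - p)) + C ((2 * r - s) * p) * (2 * X - 1) : ℤ[X]) = s * (2 * q - p) + (2 * r - s) * p * (2 * x - 1) := by
    intro x
    simp only [map_add, map_sub, map_mul, map_ofNat, map_one, aeval_C, aeval_X, algebraMap_int_eq, eq_intCast, map_intCast]
  have hdeg : (C (s * (2 * q - p)) + C ((2 * r - s) * p) * (2 * X - 1) : ℤ[X]).natDegree ≤ 3 := by
    refine (natDegree_add_le _ _).trans (max_le (by rw [natDegree_C]; omega) ((natDegree_C_mul_le _ _).trans ?_))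
    have : (2 * X - 1 : ℤ[X]).natDegree ≤ 1 := by compute_degree
    omega
  set cs : ℤ[X] := C (s * (2 * q - p)) + C ((2 * r - s) * p) * (2 * X - 1)
  obtain ⟨es, hes⟩ : ∃ es : ℤ, es = 2 * s * (2 * q - p) := ⟨_, rfl⟩
  have hesQ : (es : ℚ) = 2 * s * (2 * q - p) := by rw [hes]; push_cast; ring
  have hes0 : (es : ℚ) ≠ 0 := by rw [hesQ]; positivity
  have hc1 : aeval (1 / 2 : ℚ) cs = es / 2 := by rw [hev, hesQ]; ring
  have hc2 : aeval (q / p : ℚ) cs = es * v := by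
    rw [hev, hesQ]
    field_simp
    linear_combination -2 * hvr
  have hD : Dv ((2 * X - 1) * M) cs es := by
    refine ⟨?_, two_prim.mul hM, by exact_mod_cast hes0, hdeg, two_dvd hMh ?_ ?_⟩
    · rw [hMdef, prod_form, add_comm, ← add_assoc]
      refine natDegree_eq_of_degree_eq_some ?_
      rw [add_assoc, add_comm (C q), ← add_assoc]
      exact degree_quadratic (by omega)
    · rw [lin_dvd hMdef hp hM, aeval_Nm, hc2, ← hv]; ring
    · rw [aeval_Nm, hc1, F_half]; ring
  obtain ⟨c, e, hR, hmem, -⟩ := exists_rd hD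
  have hx1 : aeval (1 / 2 : ℚ) (C es * c - C e * cs) = 0 := half_dvd.1 ((dvd_mul_right _ _).trans hmem.2)
  have hx2 : aeval (q / p : ℚ) (C es * c - C e * cs) = 0 := (lin_dvd hMdef hp hM).1 ((dvd_mul_left _ _).trans hmem.2)
  simp only [map_sub, map_mul, aeval_C, algebraMap_int_eq, eq_intCast, map_intCast, hc1, hc2] at hx1 hx2
  have hce : aeval (q / p : ℚ) c = e * v := by
    apply mul_left_cancel₀ hes0
    linear_combination hx2
  refine ⟨c, e, hR, ?_, ?_, hce⟩
  · intro c' e' hm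
    by_cases hp2 : 2 ∣ p
    · obtain ⟨h0, h1, h2⟩ := prod_coeff p q
      refine lev_unit hR.deg hm.1 (hm.nm hR.toDv) ?_ ?_
      · rw [h1]; omega
      · rw [h2]; omega
    · exfalso
      by_cases hq2 : 2 ∣ q
      · exact even_odd_contra hp2 hq2 hR
      · refine not_mod5 hp2 hq2 (w := 2 * v - 1) ?_
        have : aeval (q / p : ℚ) F = -2 * (q / p) ^ 6 + (q / p) ^ 5 - 10 * (q / p) ^ 3 + 6 * (q / p) - 2 := by
          unfold F
          simp only [map_sub, map_add, map_mul, map_neg, map_pow, map_ofNat, aeval_X]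
        rw [this] at hv
        linear_combination 4 * hv
  · simp only [map_sub, map_mul, map_ofNat, aeval_C, algebraMap_int_eq, eq_intCast, map_intCast]
    apply mul_left_cancel₀ hes0
    linear_combination 2 * hx1

end G2

set_option linter.unusedSimpArgs false
namespace G2
open Polynomial NumberField

theorem double_half {A M c : ℤ[X]} {e s : ℤ} (hD : Dv A c e) (hA : A = C s * M ^ 2) : aeval (1 / 2 : ℚ) M ≠ 0 := by
  intro h
  obtain ⟨m, hm⟩ := half_dvd.2 h
  obtain ⟨Q, hQ⟩ := hD.dvd
  have h1 : aeval (1 / 2 : ℚ) (2 * c - C e) = 0 := by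
    have h2 := congrArg (aeval (1 / 2 : ℚ)) hQ
    rw [aeval_Nm, F_half, hA] at h2
    simp only [map_mul, map_pow, h] at h2
    have h3 : (2 * aeval (1 / 2 : ℚ) c - e) ^ 2 = 0 := by linear_combination 4 * h2
    simp only [map_sub, map_mul, map_ofNat, aeval_C, algebraMap_int_eq, eq_intCast, map_intCast]
    exact pow_eq_zero_iff (by norm_num) |>.1 h3
  obtain ⟨d, hd⟩ := half_dvd.2 h1
  have h0 : (2 * X - 1 : ℤ[X]) ≠ 0 := by
    intro h
    have := congrArg (eval 0) h
    simp at this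
  have h4 : C e ^ 2 * (4 * X ^ 5 + 20 * X ^ 2 + 10 * X - 7) = (2 * X - 1) * (4 * C s * m ^ 2 * Q - d ^ 2) := by
    apply mul_left_cancel₀ h0
    rw [hA, hm] at hQ
    unfold Nm F at hQ
    linear_combination 4 * hQ - (2 * c - C e + (2 * X - 1) * d) * hd
  have h5 := congrArg (aeval (1 / 2 : ℚ)) h4
  simp only [map_sub, map_add, map_mul, map_pow, map_ofNat, map_one, aeval_C, aeval_X, algebraMap_int_eq, eq_intCast, map_intCast] at h5
  norm_num at h5
  exact hD.ne h5

theorem desc (n : ℕ) : ∀ (A c : ℤ[X]) (e : ℤ), Rd A c e → (∀ c' e', Mem A c e c' e' → 2 ∣ e') → 2 ^ n ∣ e := by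
  induction n with
  | zero => intro A c e _ _; simp
  | succ n ih =>
    intro A c e hR hL
    have hself : Mem A c e c e := ⟨hR.degc, by simp⟩
    have h2 := hL c e hself
    rcases Nat.eq_zero_or_pos n with rfl | hn
    · simpa using h2
    obtain ⟨k, γ, hk, hγ⟩ := sq_value hR h2
    rcases halving hR.toDv (n := k) (by omega) hγ with ⟨A', c1, e1, u, hA'd, hA', he1, hm, hN, hne⟩ | ⟨M, s, hMd, hM, hs, hA⟩
    · have hD' := dv_half hA'd hA' he1 hm hN
      obtain ⟨c2, e2, hR2, hM2, htr⟩ := exists_rd hD'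
      have hdv := ih A' c2 e2 hR2 (fun c' e' h => claim2 hR.toDv hA'd hA' he1 hm hN hne hL (htr c' e' h))
      exact claim1 hR.toDv hA'd hA' he1 hm hN hne hR2 hM2 hself hn hdv
    · have hM0 := double_half hR.toDv hA
      have hform := form1 hMd.le
      obtain ⟨p, hp⟩ : ∃ p, p = M.coeff 1 := ⟨_, rfl⟩
      obtain ⟨q, hq⟩ : ∃ q, q = - M.coeff 0 := ⟨_, rfl⟩
      have hMf : M = C p * X - C q := by
        rw [hp, hq, map_neg]
        conv_lhs => rw [hform]
        ring
      have hp0 : p ≠ 0 := by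
        rw [hp]
        intro h
        have := leadingCoeff_ne_zero.2 hM.ne_zero
        rw [leadingCoeff, hMd] at this
        exact this h
      have hcop : IsCoprime p q := by
        rw [Int.isCoprime_iff_gcd_eq_one]
        have hu : IsUnit ((Int.gcd p q : ℕ) : ℤ) := by
          apply hM
          rw [hMf]
          exact dvd_sub ((map_dvd C (Int.gcd_dvd_left ..)).mul_right _) (map_dvd C (Int.gcd_dvd_right ..))
        rw [Int.isUnit_iff] at hu
        omega
      have h2q : 2 * q ≠ p := by
        intro h
        apply hM0
        rw [hMf, aeval_lin, ← h]
        push_cast; ring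
      have he : (e : ℚ) ≠ 0 := by exact_mod_cast hR.ne
      have hNm : aeval (q / p : ℚ) (Nm c e) = 0 := by
        refine (lin_dvd hMf hp0 hM).1 (dvd_trans ?_ hR.dvd)
        rw [hA]
        exact ⟨C s * M, by ring⟩
      rw [aeval_Nm] at hNm
      obtain ⟨c', e', hR', hL', h1, h3⟩ := start hcop hp0 h2q (v := aeval (q / p : ℚ) c / e) (by
        field_simp
        linear_combination hNm)
      have hdv := ih _ c' e' hR' hL'
      rw [← hMf] at hR'
      refine claim1d hR.toDv hM hA hM0 hR' h1 ?_ hn hdv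
      rw [lin_dvd hMf hp0 hM]
      simp only [map_sub, map_mul, aeval_C, algebraMap_int_eq, eq_intCast, map_intCast, h3]
      field_simp
      ring

theorem final (x y : ℚ) (h : y^2 = (2 - x) * (7*x^5 - 10*x^4 - 20*x^3 - 4)) : x = 2 ∧ y = 0 := by
  by_cases hx2 : x = 2
  · subst hx2
    refine ⟨rfl, ?_⟩
    have : y ^ 2 = 0 := by rw [h]; ring
    exact pow_eq_zero_iff (by norm_num) |>.1 this
  exfalso
  have hx0 : x ≠ 0 := by
    rintro rfl
    nlinarith [sq_nonneg y]
  have hX : ((x⁻¹.num : ℤ) : ℚ) / ((x⁻¹.den : ℤ) : ℚ) = x⁻¹ := by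
    have := Rat.num_div_den x⁻¹
    exact_mod_cast this
  have hden : ((x⁻¹.den : ℤ)) ≠ 0 := by exact_mod_cast x⁻¹.den_nz
  have hcop : IsCoprime (x⁻¹.den : ℤ) x⁻¹.num := by
    rw [Int.isCoprime_iff_gcd_eq_one, Int.gcd_comm]
    exact x⁻¹.reduced
  have h2 : 2 * x⁻¹.num ≠ (x⁻¹.den : ℤ) := by
    intro hh
    apply hx2
    have hdq : ((x⁻¹.den : ℤ) : ℚ) ≠ 0 := by exact_mod_cast hden
    have h3 : x⁻¹ = 1 / 2 := by
      rw [← hX, div_eq_div_iff hdq (by norm_num)]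
      have : (2 * x⁻¹.num : ℚ) = ((x⁻¹.den : ℤ) : ℚ) := by exact_mod_cast hh
      linear_combination this
    rw [← inv_inv x, h3]; norm_num
  obtain ⟨c, e, hR, hL, -, -⟩ := start hcop hden h2 (v := (y / x ^ 3 + 1) / 2) (by
    rw [hX]
    unfold F
    simp only [map_sub, map_add, map_mul, map_neg, map_pow, map_ofNat, aeval_X]
    field_simp
    linear_combination h)
  have hd := desc e.toNat _ c e hR hL
  have hle := Int.le_of_dvd hR.pos hd
  have hlt : e.toNat < 2 ^ e.toNat := Nat.lt_two_pow_self
  have h3 : ((e.toNat : ℕ) : ℤ) < 2 ^ e.toNat := by exact_mod_cast hlt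
  rw [Int.toNat_of_nonneg hR.pos.le] at h3
  omega

end G2


theorem genus_two_curve_rational_points (x y : ℚ) (h : y^2 = (2 - x) * (7*x^5 - 10*x^4 - 20*x^3 - 4)) : x = 2 ∧ y = 0 := 
  G2.final x y h
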